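/- arXiv:1901.08511 — 12 statements merged into one kernel-verified Lean document; each statement's English description precedes it below -/
import Mathlib

section
/- Let B be a real d×d matrix, η a real number, and x, y ∈ ℝ^d. If x' = (I + η²BBᵀ)⁻¹(x − ηBy) and y' = (I + η²BᵀB)⁻¹(y + ηBᵀx), then ‖x'‖² + ‖y'‖² = ⟪x, (I + η²BBᵀ)⁻¹x⟫ + ⟪y, (I + η²BᵀB)⁻¹y⟫. -/
open Matrix RealInnerProductSpace

theorem Matrix.isUnit_det_one_add_sq_smul_mul_transpose {m n : Type*} [Fintype m] [DecidableEq m]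
    [Fintype n] (B : Matrix m n ℝ) (η : ℝ) : IsUnit (1 + η ^ 2 • (B * Bᵀ)).det := by
  have h : (B * Bᵀ).PosSemidef := by
    simpa [conjTranspose_eq_transpose_of_trivial] using posSemidef_self_mul_conjTranspose B
  exact (isUnit_iff_isUnit_det _).1 (PosDef.one.add_posSemidef (h.smul (sq_nonneg η))).isUnit

theorem Matrix.inner_toEuclideanLin_transpose {m n : Type*} [Fintype m] [DecidableEq m]
    [Fintype n] [DecidableEq n] (B : Matrix m n ℝ) (u : EuclideanSpace ℝ m)
    (v : EuclideanSpace ℝ n) :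
    ⟪toEuclideanLin Bᵀ u, v⟫ = ⟪u, toEuclideanLin B v⟫ := by
  rw [← conjTranspose_eq_transpose_of_trivial, toEuclideanLin_conjTranspose_eq_adjoint,
    LinearMap.adjoint_inner_left]

theorem Matrix.toEuclideanLin_toEuclideanLin_of_mul_eq_one {n : Type*} [Fintype n] [DecidableEq n]
    {M N : Matrix n n ℝ} (h : M * N = 1) (u : EuclideanSpace ℝ n) :
    toEuclideanLin M (toEuclideanLin N u) = u := by
  simp only [toLpLin_apply, mulVec_mulVec, h, one_mulVec]

theorem Matrix.toEuclideanLin_one_add_smul_mul {n : Type*} [Fintype n] [DecidableEq n]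
    (C D : Matrix n n ℝ) (c : ℝ) (u : EuclideanSpace ℝ n) :
    toEuclideanLin (1 + c • (C * D)) u = u + c • toEuclideanLin C (toEuclideanLin D u) := by
  simp only [toLpLin_apply, add_mulVec, smul_mulVec, one_mulVec, mulVec_mulVec, WithLp.toLp_add,
    WithLp.toLp_smul, WithLp.toLp_ofLp]

/-- The proximal point step for a bilinear saddle function with coupling `A` and adjoint coupling
`T`, where `P` and `Q` are inverses of `1 + η² A T` and `1 + η² T A`. -/
theorem norm_sq_add_norm_sq_bilinear_prox {E F : Type*}
    [NormedAddCommGroup E] [InnerProductSpace ℝ E] [NormedAddCommGroup F] [InnerProductSpace ℝ F]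
    (A : F →ₗ[ℝ] E) (T : E →ₗ[ℝ] F) (hT : ∀ u v, ⟪T u, v⟫ = ⟪u, A v⟫)
    (P : E →ₗ[ℝ] E) (Q : F →ₗ[ℝ] F) (η : ℝ)
    (hPl : ∀ u, P (u + η ^ 2 • A (T u)) = u) (hPr : ∀ x, P x + η ^ 2 • A (T (P x)) = x)
    (hQl : ∀ v, Q (v + η ^ 2 • T (A v)) = v) (hQr : ∀ y, Q y + η ^ 2 • T (A (Q y)) = y)
    (x : E) (y : F) :
    ‖P (x - η • A y)‖ ^ 2 + ‖Q (y + η • T x)‖ ^ 2 = ⟪x, P x⟫ + ⟪y, Q y⟫ := by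
  obtain ⟨u, rfl⟩ : ∃ u, u + η ^ 2 • A (T u) = x := ⟨_, hPr x⟩
  obtain ⟨v, rfl⟩ : ∃ v, v + η ^ 2 • T (A v) = y := ⟨_, hQr y⟩
  have hx : P (u + η ^ 2 • A (T u) - η • A (v + η ^ 2 • T (A v))) = u - η • A v := by
    rw [← hPl (u - η • A v)]
    congr 1
    simp only [map_sub, map_add, map_smul]
    module
  have hy : Q (v + η ^ 2 • T (A v) + η • T (u + η ^ 2 • A (T u))) = v + η • T u := by
    rw [← hQl (v + η • T u)]
    congr 1
    simp only [map_add, map_smul]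
    module
  rw [hx, hy, hPl, hQl, norm_sub_sq_real, norm_add_sq_real]
  simp only [inner_add_left, real_inner_smul_left, real_inner_smul_right, norm_smul, mul_pow,
    Real.norm_eq_abs, sq_abs, hT, real_inner_self_eq_norm_sq]
  rw [real_inner_comm (T u) v, hT, real_inner_comm u (A (T u)), ← hT u (T u),
    real_inner_self_eq_norm_sq]
  ring

/-- One step of the proximal point method for the bilinear saddle
point problem `min_x max_y xᵀBy`: if `x' = (I + η²BBᵀ)⁻¹(x − ηBy)` and
`y' = (I + η²BᵀB)⁻¹(y + ηBᵀx)`, then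
`‖x'‖² + ‖y'‖² = ⟪x, (I + η²BBᵀ)⁻¹x⟫ + ⟪y, (I + η²BᵀB)⁻¹y⟫`. -/
theorem prox_point_bilinear_step_norm (d : ℕ) (B : Matrix (Fin d) (Fin d) ℝ) (η : ℝ)
    (x y x' y' : EuclideanSpace ℝ (Fin d))
    (hx' : x' = Matrix.toEuclideanLin ((1 + η ^ 2 • (B * Bᵀ))⁻¹)
      (x - η • Matrix.toEuclideanLin B y))
    (hy' : y' = Matrix.toEuclideanLin ((1 + η ^ 2 • (Bᵀ * B))⁻¹)
      (y + η • Matrix.toEuclideanLin Bᵀ x)) :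
    ‖x'‖ ^ 2 + ‖y'‖ ^ 2 =
      ⟪x, Matrix.toEuclideanLin ((1 + η ^ 2 • (B * Bᵀ))⁻¹) x⟫ +
      ⟪y, Matrix.toEuclideanLin ((1 + η ^ 2 • (Bᵀ * B))⁻¹) y⟫ := by
  subst hx' hy'
  have hM := B.isUnit_det_one_add_sq_smul_mul_transpose η
  have hN := Bᵀ.isUnit_det_one_add_sq_smul_mul_transpose η
  rw [transpose_transpose] at hN
  refine norm_sq_add_norm_sq_bilinear_prox _ _ B.inner_toEuclideanLin_transpose _ _ η
    (fun u => ?_) (fun u => ?_) (fun v => ?_) (fun v => ?_) x y <;>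
    rw [← toEuclideanLin_one_add_smul_mul]
  · exact toEuclideanLin_toEuclideanLin_of_mul_eq_one (nonsing_inv_mul _ hM) u
  · exact toEuclideanLin_toEuclideanLin_of_mul_eq_one (mul_nonsing_inv _ hM) u
  · exact toEuclideanLin_toEuclideanLin_of_mul_eq_one (nonsing_inv_mul _ hN) v
  · exact toEuclideanLin_toEuclideanLin_of_mul_eq_one (mul_nonsing_inv _ hN) v
end

section
/- Let B be a real d×d matrix and μ > 0 satisfy μ‖v‖² ≤ ‖Bv‖² and μ‖v‖² ≤ ‖Bᵀv‖² for all v ∈ ℝ^d. Let η > 0 and let x, y ∈ ℝ^d. Define x' = (I + η²BBᵀ)⁻¹(x − ηBy) and y' = (I + η²BᵀB)⁻¹(y + ηBᵀx). Then ‖x'‖² + ‖y'‖² ≤ (1/(1 + η²μ)) (‖x‖² + ‖y‖²). -/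
open Matrix RealInnerProductSpace

theorem isUnit_one_add_sq_smul_mul_transpose {m n : Type*} [Fintype m] [DecidableEq m]
    [Fintype n] (B : Matrix m n ℝ) (η : ℝ) : IsUnit (1 + η ^ 2 • (B * Bᵀ)) := by
  have h : (B * Bᵀ).PosSemidef := by
    simpa [conjTranspose_eq_transpose_of_trivial] using posSemidef_self_mul_conjTranspose B
  exact (PosDef.one.add_posSemidef (h.smul (sq_nonneg η))).isUnit

/-- The proximal point update is an implicit step: the updated pair satisfies `x' + ηBy' = x`. -/
theorem prox_point_implicit_step {m n : Type*} [Fintype m] [DecidableEq m] [Fintype n]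
    [DecidableEq n] (B : Matrix m n ℝ) (η : ℝ) (x : EuclideanSpace ℝ m)
    (y : EuclideanSpace ℝ n) :
    Matrix.toEuclideanLin ((1 + η ^ 2 • (B * Bᵀ))⁻¹) (x - η • Matrix.toEuclideanLin B y) +
      η • Matrix.toEuclideanLin B (Matrix.toEuclideanLin ((1 + η ^ 2 • (Bᵀ * B))⁻¹)
        (y + η • Matrix.toEuclideanLin Bᵀ x)) = x := by
  have hP : IsUnit (1 + η ^ 2 • (B * Bᵀ)).det :=
    (isUnit_iff_isUnit_det _).mp (isUnit_one_add_sq_smul_mul_transpose B η)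
  have hQ : IsUnit (1 + η ^ 2 • (Bᵀ * B)).det := by
    simpa using (isUnit_iff_isUnit_det _).mp (isUnit_one_add_sq_smul_mul_transpose Bᵀ η)
  have hcomm : B * (1 + η ^ 2 • (Bᵀ * B))⁻¹ = (1 + η ^ 2 • (B * Bᵀ))⁻¹ * B := by
    have h : (1 + η ^ 2 • (B * Bᵀ)) * B = B * (1 + η ^ 2 • (Bᵀ * B)) := by
      simp [Matrix.add_mul, Matrix.mul_add, Matrix.mul_assoc]
    calc B * (1 + η ^ 2 • (Bᵀ * B))⁻¹
        = (1 + η ^ 2 • (B * Bᵀ))⁻¹ * ((1 + η ^ 2 • (B * Bᵀ)) * B) *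
            (1 + η ^ 2 • (Bᵀ * B))⁻¹ := by rw [nonsing_inv_mul_cancel_left _ _ hP]
      _ = (1 + η ^ 2 • (B * Bᵀ))⁻¹ * B := by
          rw [h, ← Matrix.mul_assoc, mul_nonsing_inv_cancel_right _ _ hQ]
  have hB : ∀ v, Matrix.toEuclideanLin B (Matrix.toEuclideanLin ((1 + η ^ 2 • (Bᵀ * B))⁻¹) v) =
      Matrix.toEuclideanLin ((1 + η ^ 2 • (B * Bᵀ))⁻¹) (Matrix.toEuclideanLin B v) := by
    intro v
    simp [Matrix.toLpLin_apply, Matrix.mulVec_mulVec, hcomm]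
  have hx : Matrix.toEuclideanLin ((1 + η ^ 2 • (B * Bᵀ))⁻¹)
      (Matrix.toEuclideanLin (1 + η ^ 2 • (B * Bᵀ)) x) = x := by
    simp only [Matrix.toLpLin_apply, Matrix.mulVec_mulVec, nonsing_inv_mul _ hP,
      Matrix.one_mulVec]
  rw [hB, ← map_smul (Matrix.toEuclideanLin ((1 + η ^ 2 • (B * Bᵀ))⁻¹)), ← map_add]
  convert hx using 2
  ext i
  simp [Matrix.toLpLin_apply, Matrix.mulVec_add, Matrix.mulVec_smul]
  ring

/-- Linear convergence of one proximal point step for the bilinear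
saddle point problem `min_x max_y xᵀBy`: if `μ > 0` lower-bounds `λ_min(BᵀB) = λ_min(BBᵀ)`
(in the sense that `μ‖v‖² ≤ ‖Bv‖²` and `μ‖v‖² ≤ ‖Bᵀv‖²` for all `v`) and `η > 0`, then
the proximal point update `x' = (I + η²BBᵀ)⁻¹(x − ηBy)`, `y' = (I + η²BᵀB)⁻¹(y + ηBᵀx)`
satisfies `‖x'‖² + ‖y'‖² ≤ (1/(1 + η²μ)) (‖x‖² + ‖y‖²)`. -/
theorem prox_point_bilinear_contraction (d : ℕ) (B : Matrix (Fin d) (Fin d) ℝ) (μ η : ℝ)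
    (hμ : 0 < μ) (hη : 0 < η)
    (hB : ∀ v : EuclideanSpace ℝ (Fin d), μ * ‖v‖ ^ 2 ≤ ‖Matrix.toEuclideanLin B v‖ ^ 2)
    (hBt : ∀ v : EuclideanSpace ℝ (Fin d), μ * ‖v‖ ^ 2 ≤ ‖Matrix.toEuclideanLin Bᵀ v‖ ^ 2)
    (x y x' y' : EuclideanSpace ℝ (Fin d))
    (hx' : x' = Matrix.toEuclideanLin ((1 + η ^ 2 • (B * Bᵀ))⁻¹)
      (x - η • Matrix.toEuclideanLin B y))
    (hy' : y' = Matrix.toEuclideanLin ((1 + η ^ 2 • (Bᵀ * B))⁻¹)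
      (y + η • Matrix.toEuclideanLin Bᵀ x)) :
    ‖x'‖ ^ 2 + ‖y'‖ ^ 2 ≤ (1 / (1 + η ^ 2 * μ)) * (‖x‖ ^ 2 + ‖y‖ ^ 2) := by
  have hx : x = x' + η • Matrix.toEuclideanLin B y' := by
    rw [hx', hy', prox_point_implicit_step]
  have hy : y = y' - η • Matrix.toEuclideanLin Bᵀ x' := by
    have h := prox_point_implicit_step Bᵀ (-η) y x
    simp only [transpose_transpose, neg_sq, neg_smul, sub_neg_eq_add, ← sub_eq_add_neg] at h
    rw [hx', hy', h]
  have hadj : ⟪x', Matrix.toEuclideanLin B y'⟫ = ⟪y', Matrix.toEuclideanLin Bᵀ x'⟫ := by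
    rw [← conjTranspose_eq_transpose_of_trivial, toEuclideanLin_conjTranspose_eq_adjoint,
      LinearMap.adjoint_inner_right, real_inner_comm]
  have hsum : ‖x‖ ^ 2 + ‖y‖ ^ 2 = ‖x'‖ ^ 2 + ‖y'‖ ^ 2 +
      η ^ 2 * (‖Matrix.toEuclideanLin B y'‖ ^ 2 + ‖Matrix.toEuclideanLin Bᵀ x'‖ ^ 2) := by
    rw [hx, hy, norm_add_sq_real, norm_sub_sq_real, inner_smul_right, inner_smul_right, hadj,
      norm_smul, norm_smul, mul_pow, mul_pow, Real.norm_eq_abs, sq_abs]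
    ring
  rw [one_div, ← div_eq_inv_mul, le_div_iff₀ (by positivity), hsum]
  have h := mul_le_mul_of_nonneg_left (add_le_add (hB y') (hBt x')) (sq_nonneg η)
  linarith
end

section
/- Let f : ℝ^m × ℝ^n → ℝ be differentiable, μ_x-strongly convex in x for every fixed y and μ_y-strongly concave in y for every fixed x, with μ_x, μ_y > 0, and let (x*, y*) be a saddle point of f. Let η > 0 and suppose the pair (x⁺, y⁺) satisfies the implicit proximal point relations x⁺ = x − η ∇_x f(x⁺, y⁺) and y⁺ = y + η ∇_y f(x⁺, y⁺). Then, with μ = min{μ_x, μ_y}, ‖x⁺ − x*‖² + ‖y⁺ − y*‖² ≤ (1/(1 + ημ)) (‖x − x*‖² + ‖y − y*‖²). -/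
open RealInnerProductSpace

/-- Expansion of `‖p + η • g - s‖²` with the quadratic term in `η` dropped. -/
lemma norm_sub_sq_sub_le_norm_add_smul_sub_sq {E : Type*} [NormedAddCommGroup E]
    [InnerProductSpace ℝ E] (p g s : E) (η : ℝ) :
    ‖p - s‖ ^ 2 - 2 * η * ⟪g, s - p⟫ ≤ ‖p + η • g - s‖ ^ 2 := by
  have h : p + η • g - s = η • g - (s - p) := by abel
  rw [h, norm_sub_sq_real (η • g), real_inner_smul_left, norm_sub_rev p s]
  nlinarith [sq_nonneg ‖η • g‖]

/-- Linear convergence of one proximal point step for a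
`μ_x`-strongly convex–`μ_y`-strongly concave saddle point problem: if
`x⁺ = x − η ∇_x f(x⁺, y⁺)` and `y⁺ = y + η ∇_y f(x⁺, y⁺)` with `η > 0`, then, with
`μ = min{μ_x, μ_y}`,
`‖x⁺ − x*‖² + ‖y⁺ − y*‖² ≤ (1/(1 + ημ)) (‖x − x*‖² + ‖y − y*‖²)`. -/
theorem prox_point_strongly_convex_concave_contraction (m n : ℕ) (μx μy η : ℝ)
    (hμx : 0 < μx) (hμy : 0 < μy) (hη : 0 < η)
    (f : EuclideanSpace ℝ (Fin m) → EuclideanSpace ℝ (Fin n) → ℝ)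
    (hdx : ∀ y, Differentiable ℝ (fun x => f x y))
    (hdy : ∀ x, Differentiable ℝ (fun y => f x y))
    (hconv : ∀ x x' y, f x y + ⟪gradient (fun u => f u y) x, x' - x⟫
      + μx / 2 * ‖x' - x‖ ^ 2 ≤ f x' y)
    (hconc : ∀ x y y', -f x y + ⟪-(gradient (fun v => f x v) y), y' - y⟫
      + μy / 2 * ‖y' - y‖ ^ 2 ≤ -f x y')
    (xs : EuclideanSpace ℝ (Fin m)) (ys : EuclideanSpace ℝ (Fin n))
    (hsaddle : ∀ x y, f xs y ≤ f xs ys ∧ f xs ys ≤ f x ys)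
    (x xp : EuclideanSpace ℝ (Fin m)) (y yp : EuclideanSpace ℝ (Fin n))
    (hxp : xp = x - η • gradient (fun u => f u yp) xp)
    (hyp : yp = y + η • gradient (fun v => f xp v) yp) :
    ‖xp - xs‖ ^ 2 + ‖yp - ys‖ ^ 2 ≤
      (1 / (1 + η * min μx μy)) * (‖x - xs‖ ^ 2 + ‖y - ys‖ ^ 2) := by
  set gx := gradient (fun u => f u yp) xp
  set gy := gradient (fun v => f xp v) yp
  have hx : x = xp + η • gx := by rw [hxp]; abel
  have hy : y = yp + η • (-gy) := by rw [hyp, smul_neg]; abel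
  have hnx := norm_sub_sq_sub_le_norm_add_smul_sub_sq xp gx xs η
  have hny := norm_sub_sq_sub_le_norm_add_smul_sub_sq yp (-gy) ys η
  rw [← hx] at hnx
  rw [← hy] at hny
  have hcx := hconv xp xs yp
  have hcy := hconc xp yp ys
  rw [norm_sub_rev] at hcx hcy
  have hgap : ⟪gx, xs - xp⟫ + μx / 2 * ‖xp - xs‖ ^ 2
      + (⟪-gy, ys - yp⟫ + μy / 2 * ‖yp - ys‖ ^ 2) ≤ 0 := by
    linarith [(hsaddle xp yp).1, (hsaddle xp yp).2]
  have hscaled := mul_nonpos_of_nonneg_of_nonpos hη.le hgap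
  have hminx : η * (min μx μy * ‖xp - xs‖ ^ 2) ≤ η * (μx * ‖xp - xs‖ ^ 2) := by
    gcongr
    exact min_le_left _ _
  have hminy : η * (min μx μy * ‖yp - ys‖ ^ 2) ≤ η * (μy * ‖yp - ys‖ ^ 2) := by
    gcongr
    exact min_le_right _ _
  have hpos : 0 < 1 + η * min μx μy := by
    have := lt_min hμx hμy
    positivity
  rw [one_div_mul_eq_div, le_div_iff₀ hpos]
  linarith
end

section
/- There exist absolute constants c > 0 and C ≥ 1 (independent of d, B and the iterates) with the following property. Let B be a real d×d matrix and let μ, Λ > 0 satisfy μ‖v‖² ≤ ‖Bv‖² ≤ Λ‖v‖² and μ‖v‖² ≤ ‖Bᵀv‖² ≤ Λ‖v‖² for all v ∈ ℝ^d, and set η = 1/(40√Λ). If (x_k, y_k) are sequences in ℝ^d satisfying x_{k+1} = x_k − 2ηB y_k + ηB y_{k−1} and y_{k+1} = y_k + 2ηBᵀ x_k − ηBᵀ x_{k−1} for all k ≥ 1, then for all k ≥ 0, r_k ≤ C (1 − c·μ/Λ)^k · max{r_0, r_1, r_2, r_3}, where r_j := ‖x_j‖² + ‖y_j‖². -/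
open Matrix

section SkewOptimistic

variable {H : Type*} [NormedAddCommGroup H] [InnerProductSpace ℝ H]

lemma norm_add_sq_le_two_mul (a b : H) : ‖a + b‖ ^ 2 ≤ 2 * (‖a‖ ^ 2 + ‖b‖ ^ 2) := by
  nlinarith [parallelogram_law_with_norm ℝ a b, sq_nonneg ‖a - b‖]

/-- The Lyapunov function of the optimistic gradient iteration for the operator `M`, evaluated at
two consecutive iterates. -/
noncomputable def optimisticEnergy (M : H →ₗ[ℝ] H) (u v : H) : ℝ :=
  ‖v - M v + M u‖ ^ 2 + 1 / 2 * ‖M u‖ ^ 2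

lemma optimisticEnergy_nonneg (M : H →ₗ[ℝ] H) (u v : H) : 0 ≤ optimisticEnergy M u v := by
  unfold optimisticEnergy
  positivity

variable {M : H →ₗ[ℝ] H} {m : ℝ}

lemma optimisticEnergy_step (hm0 : 0 < m) (hm1 : m ≤ 1 / 1600)
    (hskew : ∀ z, inner ℝ z (M z) = 0) (hlow : ∀ z, m * ‖z‖ ^ 2 ≤ ‖M z‖ ^ 2)
    (hup : ∀ z, ‖M z‖ ^ 2 ≤ 1 / 1600 * ‖z‖ ^ 2) (u v : H) :
    optimisticEnergy M v (v - (2 : ℝ) • M v + M u) ≤ (1 - m / 100) * optimisticEnergy M u v := by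
  set p := v - (2 : ℝ) • M v + M u with hp
  set w := v - M v + M u with hw
  have hwp : w = p + M v := by rw [hp, hw]; module
  have hnext : p - M p + M v = w - M p := by rw [hwp]; abel
  have hinner : inner ℝ w (M p) = inner ℝ (M v) (M p) := by
    rw [hwp, inner_add_left, hskew, zero_add]
  have hdiff : ‖M p - M v‖ ^ 2 ≤ 1 / 1600 * (8 * ‖M v‖ ^ 2 + 2 * ‖M u‖ ^ 2) := by
    have hpv : p - v = (-2 : ℝ) • M v + M u := by rw [hp]; module
    have h := norm_add_sq_le_two_mul ((-2 : ℝ) • M v) (M u)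
    rw [← hpv, norm_smul, mul_pow] at h
    norm_num at h
    rw [← map_sub]
    linarith [hup (p - v)]
  have hwsq : ‖w‖ ^ 2 ≤ 4 * ‖v‖ ^ 2 + 4 * ‖M v‖ ^ 2 + 2 * ‖M u‖ ^ 2 := by
    have h₁ := norm_add_sq_le_two_mul (v - M v) (M u)
    have h₂ := norm_add_sq_le_two_mul v (-M v)
    rw [norm_neg, ← sub_eq_add_neg] at h₂
    linarith
  have e₁ := norm_sub_sq_real w (M p)
  have e₂ := norm_sub_sq_real (M p) (M v)
  rw [real_inner_comm] at e₂
  rw [hinner] at e₁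
  have hmw := mul_le_mul_of_nonneg_left hwsq hm0.le
  have hmv := mul_le_mul_of_nonneg_right hm1 (sq_nonneg ‖M v‖)
  have hmu := mul_le_mul_of_nonneg_right hm1 (sq_nonneg ‖M u‖)
  unfold optimisticEnergy
  rw [hnext, ← hw]
  nlinarith [hlow v, sq_nonneg ‖M v‖, sq_nonneg ‖M u‖]

lemma norm_sq_le_optimisticEnergy (hm0 : 0 < m) (hm1 : m ≤ 1 / 1600)
    (hskew : ∀ z, inner ℝ z (M z) = 0) (hlow : ∀ z, m * ‖z‖ ^ 2 ≤ ‖M z‖ ^ 2)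
    (hup : ∀ z, ‖M z‖ ^ 2 ≤ 1 / 1600 * ‖z‖ ^ 2) (u v : H) :
    ‖v - (2 : ℝ) • M v + M u‖ ^ 2 ≤ 6 * optimisticEnergy M u v := by
  have hstep := optimisticEnergy_step hm0 hm1 hskew hlow hup u v
  have hV := optimisticEnergy_nonneg M u v
  have hle : optimisticEnergy M v (v - (2 : ℝ) • M v + M u) ≤ optimisticEnergy M u v := by
    nlinarith
  have h := norm_add_sq_le_two_mul (v - M v + M u) (-M v)
  rw [norm_neg, show v - M v + M u + -M v = v - (2 : ℝ) • M v + M u by module] at h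
  have h₁ : ‖v - M v + M u‖ ^ 2 ≤ optimisticEnergy M u v := by
    unfold optimisticEnergy
    nlinarith [sq_nonneg ‖M u‖]
  have h₂ : 1 / 2 * ‖M v‖ ^ 2 ≤ optimisticEnergy M v (v - (2 : ℝ) • M v + M u) := by
    unfold optimisticEnergy
    nlinarith [sq_nonneg ‖v - (2 : ℝ) • M v + M u - M (v - (2 : ℝ) • M v + M u) + M v‖]
  linarith

lemma optimisticEnergy_initial_le (hup : ∀ z, ‖M z‖ ^ 2 ≤ 1 / 1600 * ‖z‖ ^ 2) {R : ℝ} {u v : H}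
    (hu : ‖u‖ ^ 2 ≤ R) (hv : ‖v‖ ^ 2 ≤ R) : optimisticEnergy M u v ≤ 5 * R := by
  have h₁ := norm_add_sq_le_two_mul (v - M v) (M u)
  have h₂ := norm_add_sq_le_two_mul v (-M v)
  rw [norm_neg, ← sub_eq_add_neg] at h₂
  unfold optimisticEnergy
  linarith [hup u, hup v, sq_nonneg ‖u‖]

/-- Linear convergence of the optimistic gradient iteration for a well-conditioned skew operator. -/
lemma optimistic_gradient_linear_convergence (hm0 : 0 < m) (hm1 : m ≤ 1 / 1600)
    (hskew : ∀ z, inner ℝ z (M z) = 0) (hlow : ∀ z, m * ‖z‖ ^ 2 ≤ ‖M z‖ ^ 2)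
    (hup : ∀ z, ‖M z‖ ^ 2 ≤ 1 / 1600 * ‖z‖ ^ 2) {z : ℕ → H}
    (hz : ∀ n, z (n + 2) = z (n + 1) - (2 : ℝ) • M (z (n + 1)) + M (z n)) {R : ℝ}
    (h0 : ‖z 0‖ ^ 2 ≤ R) (h1 : ‖z 1‖ ^ 2 ≤ R) (k : ℕ) :
    ‖z k‖ ^ 2 ≤ 60 * (1 - m / 100) ^ k * R := by
  have hR : 0 ≤ R := (sq_nonneg _).trans h0
  have hq : 9 / 10 ≤ 1 - m / 100 := by linarith
  have hV : ∀ n, optimisticEnergy M (z n) (z (n + 1)) ≤ (1 - m / 100) ^ n * (5 * R) := by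
    intro n
    induction n with
    | zero => simpa using optimisticEnergy_initial_le hup h0 h1
    | succ n ih =>
      have h := optimisticEnergy_step hm0 hm1 hskew hlow hup (z n) (z (n + 1))
      rw [← hz] at h
      calc _ ≤ _ := h
        _ ≤ (1 - m / 100) * ((1 - m / 100) ^ n * (5 * R)) :=
          mul_le_mul_of_nonneg_left ih (by linarith)
        _ = _ := by ring
  match k with
  | 0 => simp only [pow_zero]; linarith
  | 1 => simp only [pow_one]; nlinarith
  | n + 2 =>
    have h := norm_sq_le_optimisticEnergy hm0 hm1 hskew hlow hup (z n) (z (n + 1))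
    rw [← hz] at h
    have hpow : 0 ≤ (1 - m / 100) ^ n * R := mul_nonneg (pow_nonneg (by linarith) n) hR
    have hsq : 1 / 2 ≤ (1 - m / 100) ^ 2 := by nlinarith
    calc _ ≤ _ := h
      _ ≤ 6 * ((1 - m / 100) ^ n * (5 * R)) := by linarith [hV n]
      _ = 60 * (1 / 2) * ((1 - m / 100) ^ n * R) := by ring
      _ ≤ 60 * (1 - m / 100) ^ 2 * ((1 - m / 100) ^ n * R) := by gcongr
      _ = _ := by ring

end SkewOptimistic

section Bilinear

variable {d : ℕ}

/-- The gradient operator `(x, y) ↦ (B y, -Bᵀ x)` of the saddle point problem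
`min_x max_y xᵀBy`. -/
noncomputable def bilinearSaddleOperator (B : Matrix (Fin d) (Fin d) ℝ) :
    WithLp 2 (EuclideanSpace ℝ (Fin d) × EuclideanSpace ℝ (Fin d)) →ₗ[ℝ]
      WithLp 2 (EuclideanSpace ℝ (Fin d) × EuclideanSpace ℝ (Fin d)) where
  toFun z := WithLp.toLp 2 (Matrix.toEuclideanLin B z.snd, -Matrix.toEuclideanLin Bᵀ z.fst)
  map_add' z w := by
    refine WithLp.ofLp_injective 2 (Prod.ext ?_ ?_)
    · simp
    · simp [add_comm]
  map_smul' c z := by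
    refine WithLp.ofLp_injective 2 (Prod.ext ?_ ?_) <;> simp

lemma inner_bilinearSaddleOperator_self (B : Matrix (Fin d) (Fin d) ℝ)
    (z : WithLp 2 (EuclideanSpace ℝ (Fin d) × EuclideanSpace ℝ (Fin d))) :
    inner ℝ z (bilinearSaddleOperator B z) = 0 := by
  have hadj : Matrix.toEuclideanLin Bᵀ = (Matrix.toEuclideanLin B).adjoint := by
    rw [← Matrix.toEuclideanLin_conjTranspose_eq_adjoint, Matrix.conjTranspose_eq_transpose_of_trivial]
  simp only [WithLp.prod_inner_apply, bilinearSaddleOperator, LinearMap.coe_mk, AddHom.coe_mk,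
    hadj, inner_neg_right]
  have h := LinearMap.adjoint_inner_left (Matrix.toEuclideanLin B) z.snd z.fst
  have h' := real_inner_comm z.snd ((Matrix.toEuclideanLin B).adjoint z.fst)
  simp only [WithLp.ofLp_fst, WithLp.ofLp_snd] at *
  linarith

lemma norm_sq_bilinearSaddleOperator (B : Matrix (Fin d) (Fin d) ℝ)
    (z : WithLp 2 (EuclideanSpace ℝ (Fin d) × EuclideanSpace ℝ (Fin d))) :
    ‖bilinearSaddleOperator B z‖ ^ 2 =
      ‖Matrix.toEuclideanLin B z.snd‖ ^ 2 + ‖Matrix.toEuclideanLin Bᵀ z.fst‖ ^ 2 := by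
  simp [WithLp.prod_norm_sq_eq_of_L2, bilinearSaddleOperator]

end Bilinear

/-- Linear convergence of OGDA with stepsize `η = 1/(40√Λ)` for the
bilinear saddle point problem `min_x max_y xᵀBy`: there are absolute constants
`c > 0` and `C ≥ 1` such that `r_k ≤ C (1 − cμ/Λ)^k · max{r_0, r_1, r_2, r_3}`,
where `r_j = ‖x_j‖² + ‖y_j‖²`. -/
theorem ogda_bilinear_linear_convergence :
    ∃ c : ℝ, 0 < c ∧ ∃ C : ℝ, 1 ≤ C ∧
    ∀ (d : ℕ) (B : Matrix (Fin d) (Fin d) ℝ) (μ Λ η : ℝ), 0 < μ → 0 < Λ →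
    (∀ v : EuclideanSpace ℝ (Fin d), μ * ‖v‖ ^ 2 ≤ ‖Matrix.toEuclideanLin B v‖ ^ 2) →
    (∀ v : EuclideanSpace ℝ (Fin d), ‖Matrix.toEuclideanLin B v‖ ^ 2 ≤ Λ * ‖v‖ ^ 2) →
    (∀ v : EuclideanSpace ℝ (Fin d), μ * ‖v‖ ^ 2 ≤ ‖Matrix.toEuclideanLin Bᵀ v‖ ^ 2) →
    (∀ v : EuclideanSpace ℝ (Fin d), ‖Matrix.toEuclideanLin Bᵀ v‖ ^ 2 ≤ Λ * ‖v‖ ^ 2) →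
    η = 1 / (40 * Real.sqrt Λ) →
    ∀ x y : ℕ → EuclideanSpace ℝ (Fin d),
    (∀ k, 1 ≤ k → x (k + 1) =
      x k - (2 * η) • Matrix.toEuclideanLin B (y k) + η • Matrix.toEuclideanLin B (y (k - 1))) →
    (∀ k, 1 ≤ k → y (k + 1) =
      y k + (2 * η) • Matrix.toEuclideanLin Bᵀ (x k) - η • Matrix.toEuclideanLin Bᵀ (x (k - 1))) →
    ∀ r : ℕ → ℝ, (∀ j, r j = ‖x j‖ ^ 2 + ‖y j‖ ^ 2) →
    ∀ k : ℕ, r k ≤ C * (1 - c * μ / Λ) ^ k * max (max (r 0) (r 1)) (max (r 2) (r 3)) := by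
  refine ⟨1 / 160000, by norm_num, 60, by norm_num, ?_⟩
  intro d B μ Λ η hμ hΛ hB₁ hB₂ hBt₁ hBt₂ hη x y hx hy r hr k
  have hR0 : r 0 ≤ max (max (r 0) (r 1)) (max (r 2) (r 3)) := by simp
  have hR1 : r 1 ≤ max (max (r 0) (r 1)) (max (r 2) (r 3)) := by simp
  rcases lt_or_ge Λ μ with hlt | hle
  · have hzero : ∀ v : EuclideanSpace ℝ (Fin d), ‖v‖ ^ 2 = 0 := fun v => by
      nlinarith [hB₁ v, hB₂ v, sq_nonneg ‖v‖]
    have hr0 : ∀ j, r j = 0 := fun j => by rw [hr, hzero, hzero, add_zero]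
    simp [hr0]
  have hη2 : η ^ 2 = 1 / (1600 * Λ) := by
    rw [hη, div_pow, mul_pow, Real.sq_sqrt hΛ.le]
    norm_num
  set z : ℕ → WithLp 2 (EuclideanSpace ℝ (Fin d) × EuclideanSpace ℝ (Fin d)) :=
    fun n => WithLp.toLp 2 (x n, y n) with hz
  have hzr : ∀ n, ‖z n‖ ^ 2 = r n := fun n => by
    simp [hz, hr, WithLp.prod_norm_sq_eq_of_L2]
  have hnorm : ∀ w, ‖(η • bilinearSaddleOperator B) w‖ ^ 2 = 1 / (1600 * Λ) *
      (‖Matrix.toEuclideanLin B w.snd‖ ^ 2 + ‖Matrix.toEuclideanLin Bᵀ w.fst‖ ^ 2) := fun w => by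
    rw [LinearMap.smul_apply, norm_smul, mul_pow, norm_sq_bilinearSaddleOperator,
      Real.norm_eq_abs, sq_abs, hη2]
  have key := optimistic_gradient_linear_convergence (M := η • bilinearSaddleOperator B)
    (m := μ / (1600 * Λ)) (by positivity) ?_ ?_ ?_ ?_ (z := z) ?_
    ((hzr 0).trans_le hR0) ((hzr 1).trans_le hR1) k
  · rw [hzr] at key
    convert key using 4
    field_simp
    ring
  · rw [div_le_div_iff₀ (by positivity) (by norm_num)]
    linarith
  · intro w
    rw [LinearMap.smul_apply, inner_smul_right, inner_bilinearSaddleOperator_self, mul_zero]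
  · intro w
    rw [hnorm, WithLp.prod_norm_sq_eq_of_L2]
    calc _ = 1 / (1600 * Λ) * (μ * ‖w.snd‖ ^ 2 + μ * ‖w.fst‖ ^ 2) := by ring
      _ ≤ _ := mul_le_mul_of_nonneg_left (add_le_add (hB₁ _) (hBt₁ _)) (by positivity)
  · intro w
    rw [hnorm, WithLp.prod_norm_sq_eq_of_L2]
    calc _ ≤ 1 / (1600 * Λ) * (Λ * ‖w.snd‖ ^ 2 + Λ * ‖w.fst‖ ^ 2) :=
          mul_le_mul_of_nonneg_left (add_le_add (hB₂ _) (hBt₂ _)) (by positivity)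
      _ = 1 / 1600 * (‖w.fst‖ ^ 2 + ‖w.snd‖ ^ 2) := by field_simp; ring
  · intro n
    have hxn := hx (n + 1) (by omega)
    have hyn := hy (n + 1) (by omega)
    rw [Nat.add_sub_cancel] at hxn hyn
    refine WithLp.ofLp_injective 2 (Prod.ext ?_ ?_)
    · simp only [hz, bilinearSaddleOperator]
      simp [hxn]
      module
    · simp only [hz, bilinearSaddleOperator]
      simp [hyn]
      module
end

section
/- Let (H, ⟪·,·⟫) be a real inner product space, let 0 < μ ≤ L, and let F : H → H be L-Lipschitz and μ-strongly monotone with F(z*) = 0 for some z* ∈ H. Let 0 < η ≤ 1/(4L) and let (z_k) satisfy the OGDA recursion z_{k+1} = z_k − 2ηF(z_k) + ηF(z_{k−1}) for all k ≥ 1. Then for every k ≥ 2, ‖z_k − η(F(z_k) − F(z_{k−1})) − z*‖² + η²L²‖z_k − z_{k−1}‖² ≤ (1 − ημ) · (‖z_{k−1} − η(F(z_{k−1}) − F(z_{k−2})) − z*‖² + η²L²‖z_{k−1} − z_{k−2}‖²). -/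
open RealInnerProductSpace

/-- The parallelogram bound `‖x + y‖² ≤ 2‖x‖² + 2‖y‖²`. -/
theorem norm_add_sq_le_two_mul_add {E : Type*} [SeminormedAddCommGroup E] (x y : E) :
    ‖x + y‖ ^ 2 ≤ 2 * ‖x‖ ^ 2 + 2 * ‖y‖ ^ 2 := by
  have h := pow_le_pow_left₀ (norm_nonneg _) (norm_add_le x y) 2
  nlinarith [sq_nonneg (‖x‖ - ‖y‖)]

/-- Lyapunov decrease for one optimistic step. Here `w` is the shifted old iterate, `x = w - b` the
new iterate relative to the solution, `a`, `b`, `c` the scaled operator values at the new, current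
and previous points, and `d` the previous displacement. -/
theorem optimistic_step_contraction {H : Type*} [NormedAddCommGroup H] [InnerProductSpace ℝ H]
    {m q : ℝ} (hm : 0 < m) (hmq : m ≤ q) (hq : q ≤ 1 / 4) {a b c d x : H}
    (hmono : m * ‖x‖ ^ 2 ≤ ⟪a, x⟫)
    (hab : ‖a - b‖ ^ 2 ≤ q ^ 2 * ‖b + (b - c)‖ ^ 2)
    (hbc : ‖b - c‖ ^ 2 ≤ q ^ 2 * ‖d‖ ^ 2) :
    ‖x + b - a‖ ^ 2 + q ^ 2 * ‖b + (b - c)‖ ^ 2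
      ≤ (1 - m) * (‖x + b‖ ^ 2 + q ^ 2 * ‖d‖ ^ 2) := by
  have hexpand : ‖x + b - a‖ ^ 2 = ‖x + b‖ ^ 2 - 2 * ⟪a, x⟫ + ‖a - b‖ ^ 2 - ‖b‖ ^ 2 := by
    rw [norm_sub_sq_real (x + b) a, norm_sub_sq_real a b, inner_add_left,
      real_inner_comm a x, real_inner_comm a b]
    ring
  have hq2 : q ^ 2 ≤ 1 / 16 := by nlinarith
  have hdisp : q ^ 2 * ‖b + (b - c)‖ ^ 2 ≤ q ^ 2 * (2 * ‖b‖ ^ 2 + 2 * (q ^ 2 * ‖d‖ ^ 2)) :=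
    mul_le_mul_of_nonneg_left ((norm_add_sq_le_two_mul_add b (b - c)).trans (by linarith))
      (sq_nonneg q)
  have hw := mul_le_mul_of_nonneg_left (norm_add_sq_le_two_mul_add x b) hm.le
  have hb : 0 ≤ (1 - 2 * m - 4 * q ^ 2) * ‖b‖ ^ 2 :=
    mul_nonneg (by linarith) (sq_nonneg _)
  have hd : 0 ≤ (1 - m - 4 * q ^ 2) * (q ^ 2 * ‖d‖ ^ 2) :=
    mul_nonneg (by linarith) (by positivity)
  linarith

/-- One-step contraction of a Lyapunov function for the OGDA iteration
`z_{k+1} = z_k − 2ηF(z_k) + ηF(z_{k−1})` for an `L`-Lipschitz, `μ`-strongly monotone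
operator `F` with zero `z*` and stepsize `0 < η ≤ 1/(4L)`: for `k ≥ 2`,
`‖z_k − η(F(z_k) − F(z_{k−1})) − z*‖² + η²L²‖z_k − z_{k−1}‖²
  ≤ (1 − ημ)(‖z_{k−1} − η(F(z_{k−1}) − F(z_{k−2})) − z*‖² + η²L²‖z_{k−1} − z_{k−2}‖²)`. -/
theorem ogda_lyapunov_contraction (H : Type*) [NormedAddCommGroup H] [InnerProductSpace ℝ H]
    (μ L η : ℝ) (hμ : 0 < μ) (hμL : μ ≤ L) (hη0 : 0 < η) (hη : η ≤ 1 / (4 * L))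
    (F : H → H)
    (hLip : ∀ z w : H, ‖F z - F w‖ ≤ L * ‖z - w‖)
    (hmono : ∀ z w : H, μ * ‖z - w‖ ^ 2 ≤ ⟪F z - F w, z - w⟫)
    (zs : H) (hzs : F zs = 0)
    (z : ℕ → H)
    (hrec : ∀ k, 1 ≤ k → z (k + 1) = z k - (2 * η) • F (z k) + η • F (z (k - 1))) :
    ∀ k, 2 ≤ k →
      ‖z k - η • (F (z k) - F (z (k - 1))) - zs‖ ^ 2 + η ^ 2 * L ^ 2 * ‖z k - z (k - 1)‖ ^ 2 ≤
      (1 - η * μ) * (‖z (k - 1) - η • (F (z (k - 1)) - F (z (k - 2))) - zs‖ ^ 2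
        + η ^ 2 * L ^ 2 * ‖z (k - 1) - z (k - 2)‖ ^ 2) := by
  intro k hk
  obtain ⟨n, rfl⟩ : ∃ n, k = n + 2 := ⟨k - 2, by omega⟩
  have hL : 0 < L := hμ.trans_le hμL
  have hstep : z (n + 2) = z (n + 1) - (2 * η) • F (z (n + 1)) + η • F (z n) :=
    hrec (n + 1) (by omega)
  have hscaled (u v : H) : ‖η • F u - η • F v‖ ^ 2 ≤ (η * L) ^ 2 * ‖u - v‖ ^ 2 := by
    rw [← smul_sub, norm_smul, Real.norm_of_nonneg hη0.le, ← mul_pow, mul_assoc]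
    exact pow_le_pow_left₀ (by positivity)
      (mul_le_mul_of_nonneg_left (hLip u v) hη0.le) 2
  have hdisp : ‖z (n + 2) - z (n + 1)‖
      = ‖η • F (z (n + 1)) + (η • F (z (n + 1)) - η • F (z n))‖ := by
    rw [← norm_neg, hstep]
    congr 1
    module
  have hmonos : η * μ * ‖z (n + 2) - zs‖ ^ 2 ≤ ⟪η • F (z (n + 2)), z (n + 2) - zs⟫ := by
    have h := hmono (z (n + 2)) zs
    rw [hzs, sub_zero] at h
    rw [real_inner_smul_left, mul_assoc]
    exact mul_le_mul_of_nonneg_left h hη0.le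
  have hq : η * L ≤ 1 / 4 := by
    rw [le_div_iff₀ (by positivity)] at hη
    linarith
  have hlip := hscaled (z (n + 2)) (z (n + 1))
  rw [hdisp] at hlip
  have key := optimistic_step_contraction (mul_pos hη0 hμ)
    (mul_le_mul_of_nonneg_left hμL hη0.le) hq hmonos hlip (hscaled (z (n + 1)) (z n))
  have hnew : z (n + 2) - η • (F (z (n + 2)) - F (z (n + 1))) - zs
      = z (n + 2) - zs + η • F (z (n + 1)) - η • F (z (n + 2)) := by module
  have hold : z (n + 1) - η • (F (z (n + 1)) - F (z n)) - zs
      = z (n + 2) - zs + η • F (z (n + 1)) := by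
    rw [hstep]
    module
  simp only [Nat.add_sub_cancel, show n + 2 - 1 = n + 1 from rfl]
  rw [hnew, hold, hdisp, ← mul_pow]
  exact key
end

section
/- Let (H, ⟪·,·⟫) be a real inner product space, let 0 < μ ≤ L, and let F : H → H be L-Lipschitz and μ-strongly monotone with F(z*) = 0 for some z* ∈ H. Set η = 1/(4L) and let (z_k) satisfy z_{k+1} = z_k − 2ηF(z_k) + ηF(z_{k−1}) for all k ≥ 1. Then for every k ≥ 1, (μ²/(16L²)) ‖z_{k+1} − z*‖² ≤ 4 · max{‖z_{k+1} − z_k‖², ‖z_k − z_{k−1}‖²}. -/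
open RealInnerProductSpace

/-- A strongly monotone operator expands distances by at least its modulus. -/
theorem mul_norm_sub_le_of_strongly_monotone {H : Type*} [NormedAddCommGroup H]
    [InnerProductSpace ℝ H] {μ : ℝ} {F : H → H}
    (hmono : ∀ z w : H, μ * ‖z - w‖ ^ 2 ≤ ⟪F z - F w, z - w⟫) (z w : H) :
    μ * ‖z - w‖ ≤ ‖F z - F w‖ := by
  rcases (norm_nonneg (z - w)).eq_or_lt with h | h
  · rw [← h, mul_zero]
    exact norm_nonneg _
  · refine le_of_mul_le_mul_right ?_ h
    calc μ * ‖z - w‖ * ‖z - w‖ = μ * ‖z - w‖ ^ 2 := by ring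
      _ ≤ ⟪F z - F w, z - w⟫ := hmono z w
      _ ≤ ‖F z - F w‖ * ‖z - w‖ := real_inner_le_norm _ _

/-- One optimistic gradient step from `y`, with previous iterate `x` and next iterate `w`,
bounds the scaled operator at `w` by the lengths of the two steps. -/
theorem norm_smul_le_of_optimistic_step {H : Type*} [NormedAddCommGroup H] [NormedSpace ℝ H]
    {L η : ℝ} {F : H → H} (hη : 0 ≤ η) (hLip : ∀ z w : H, ‖F z - F w‖ ≤ L * ‖z - w‖)
    {x y w : H} (hw : w = y - (2 * η) • F y + η • F x) :
    ‖η • F w‖ ≤ (1 + η * L) * ‖w - y‖ + η * L * ‖y - x‖ := by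
  have hsmul (u v : H) : ‖η • (F u - F v)‖ ≤ η * L * ‖u - v‖ := by
    rw [norm_smul, Real.norm_of_nonneg hη, mul_assoc]
    exact mul_le_mul_of_nonneg_left (hLip u v) hη
  have hdecomp : η • F w = η • (F w - F y) - (w - y) - η • (F y - F x) := by
    have hwy : w - y = η • F x - (2 * η) • F y := by
      rw [hw]
      abel
    rw [hwy]
    module
  calc ‖η • F w‖ ≤ ‖η • (F w - F y)‖ + ‖w - y‖ + ‖η • (F y - F x)‖ := by
        rw [hdecomp]
        exact (norm_sub_le _ _).trans (add_le_add_left (norm_sub_le _ _) _)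
    _ ≤ (1 + η * L) * ‖w - y‖ + η * L * ‖y - x‖ := by
        linarith [hsmul w y, hsmul y x]

/-- For the OGDA iteration `z_{k+1} = z_k − 2ηF(z_k) + ηF(z_{k−1})`
applied to an `L`-Lipschitz, `μ`-strongly monotone operator `F` with zero `z*` and
stepsize `η = 1/(4L)`: for all `k ≥ 1`,
`(μ²/(16L²)) ‖z_{k+1} − z*‖² ≤ 4 · max{‖z_{k+1} − z_k‖², ‖z_k − z_{k−1}‖²}`. -/
theorem ogda_distance_bounded_by_successive_iterates (H : Type*) [NormedAddCommGroup H]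
    [InnerProductSpace ℝ H]
    (μ L η : ℝ) (hμ : 0 < μ) (hμL : μ ≤ L) (hη : η = 1 / (4 * L))
    (F : H → H)
    (hLip : ∀ z w : H, ‖F z - F w‖ ≤ L * ‖z - w‖)
    (hmono : ∀ z w : H, μ * ‖z - w‖ ^ 2 ≤ ⟪F z - F w, z - w⟫)
    (zs : H) (hzs : F zs = 0)
    (z : ℕ → H)
    (hrec : ∀ k, 1 ≤ k → z (k + 1) = z k - (2 * η) • F (z k) + η • F (z (k - 1))) :
    ∀ k, 1 ≤ k → μ ^ 2 / (16 * L ^ 2) * ‖z (k + 1) - zs‖ ^ 2 ≤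
      4 * max (‖z (k + 1) - z k‖ ^ 2) (‖z k - z (k - 1)‖ ^ 2) := by
  intro k hk
  have hL : 0 < L := hμ.trans_le hμL
  have hη0 : 0 ≤ η := by
    rw [hη]
    positivity
  have hηL : η * L = 1 / 4 := by
    rw [hη]
    field_simp
  have hstep := norm_smul_le_of_optimistic_step hη0 hLip (hrec k hk)
  have hdist := mul_norm_sub_le_of_strongly_monotone hmono (z (k + 1)) zs
  rw [hzs, sub_zero] at hdist
  rw [norm_smul, Real.norm_of_nonneg hη0, hηL] at hstep
  have hcoef : μ ^ 2 / (16 * L ^ 2) = (η * μ) ^ 2 := by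
    rw [hη]
    field_simp
    norm_num
  set a := ‖z (k + 1) - z k‖
  set b := ‖z k - z (k - 1)‖
  have hbound : η * μ * ‖z (k + 1) - zs‖ ≤ 5 / 4 * a + 1 / 4 * b := by
    linarith [mul_le_mul_of_nonneg_left hdist hη0]
  have hmaxa := le_max_left (a ^ 2) (b ^ 2)
  have hmaxb := le_max_right (a ^ 2) (b ^ 2)
  calc μ ^ 2 / (16 * L ^ 2) * ‖z (k + 1) - zs‖ ^ 2
      = (η * μ * ‖z (k + 1) - zs‖) ^ 2 := by rw [hcoef, mul_pow (η * μ)]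
    _ ≤ (5 / 4 * a + 1 / 4 * b) ^ 2 := by gcongr
    _ ≤ 4 * max (a ^ 2) (b ^ 2) := by linarith [sq_nonneg (a - b), sq_nonneg a, sq_nonneg b]
end

section
/- Let f : ℝ^m × ℝ^n → ℝ be differentiable, μ-strongly convex in x for every fixed y and μ-strongly concave in y for every fixed x, with saddle point (x*, y*), and suppose the map G(x,y) = (∇_x f(x,y), −∇_y f(x,y)) on ℝ^m × ℝ^n is L-Lipschitz, where 0 < μ ≤ L. Set η = 1/(4L). Let (x_k, y_k)_{k≥0} satisfy (x_1, y_1) = (x_0, y_0) − ηG(x_0, y_0) and, for all k ≥ 1, x_{k+1} = x_k − 2η∇_x f(x_k, y_k) + η∇_x f(x_{k−1}, y_{k−1}) and y_{k+1} = y_k + 2η∇_y f(x_k, y_k) − η∇_y f(x_{k−1}, y_{k−1}). Then for every k ≥ 0, with r_j := ‖x_j − x*‖² + ‖y_j − y*‖², one has r_{k+1} ≤ (1 − μ/(4L))^k · 1024 (L/μ)² · r_0. -/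
open RealInnerProductSpace

section OptimisticGradient

variable {E : Type*} [NormedAddCommGroup E] [InnerProductSpace ℝ E]

theorem norm_sq_add_le_two_mul (u v : E) : ‖u + v‖ ^ 2 ≤ 2 * ‖u‖ ^ 2 + 2 * ‖v‖ ^ 2 := by
  nlinarith [parallelogram_law_with_norm ℝ u v, sq_nonneg ‖u - v‖]

/-- One step of the optimistic gradient method in terms of the shifted iterate `w = u + b`, where
`b` and `a` are the previous and the current scaled operator values, and `u` is the current iterate
relative to the solution. -/
theorem optimistic_gradient_shifted_step {c : ℝ} (hc : 0 ≤ c) {u a b : E}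
    (h : c * ‖u‖ ^ 2 ≤ ⟪a, u⟫) :
    ‖u + b - a‖ ^ 2 ≤ (1 - c) * ‖u + b‖ ^ 2 + ‖a - b‖ ^ 2 - (1 - 2 * c) * ‖b‖ ^ 2 := by
  have expand : ‖u + b - a‖ ^ 2 = ‖u + b‖ ^ 2 - 2 * ⟪a, u⟫ + ‖a - b‖ ^ 2 - ‖b‖ ^ 2 := by
    rw [norm_sub_sq_real, norm_sub_sq_real, inner_add_left, real_inner_comm a u,
      real_inner_comm a b]
    ring
  nlinarith [mul_le_mul_of_nonneg_left (norm_sq_add_le_two_mul u b) hc]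

/-- Linear convergence of the optimistic gradient method `z (k + 2) = z (k + 1) - 2 h (k + 1) + h k`
for scaled operator values `h` which are strongly monotone with respect to the solution `zs` and
`1/4`-Lipschitz along the iterates. -/
theorem optimistic_gradient_linear_convergence_s9 {c : ℝ} (hc : 0 ≤ c) (hc' : c ≤ 1 / 4)
    {z h : ℕ → E} {zs : E}
    (hmono : ∀ k, c * ‖z k - zs‖ ^ 2 ≤ ⟪h k, z k - zs⟫)
    (hlip : ∀ j k, ‖h j - h k‖ ^ 2 ≤ 1 / 16 * ‖z j - z k‖ ^ 2)
    (hbound : ∀ k, ‖h k‖ ^ 2 ≤ 1 / 16 * ‖z k - zs‖ ^ 2)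
    (hz1 : z 1 = z 0 - h 0)
    (hz : ∀ k, z (k + 2) = z (k + 1) - (2 : ℝ) • h (k + 1) + h k) (k : ℕ) :
    ‖z (k + 1) - zs‖ ^ 2 ≤ 4 * (1 - c) ^ k * ‖z 0 - zs‖ ^ 2 := by
  have shifted (k : ℕ) : ‖z (k + 2) - zs + h (k + 1)‖ ^ 2 ≤
      (1 - c) * ‖z (k + 1) - zs + h k‖ ^ 2 + ‖h (k + 1) - h k‖ ^ 2 - 1 / 2 * ‖h k‖ ^ 2 := by
    have key := optimistic_gradient_shifted_step hc (b := h k) (hmono (k + 1))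
    have hw : z (k + 2) - zs + h (k + 1) = z (k + 1) - zs + h k - h (k + 1) := by
      rw [hz]; module
    rw [hw]
    nlinarith [sq_nonneg ‖h k‖]
  have lyapunov (k : ℕ) : ‖z (k + 2) - zs + h (k + 1)‖ ^ 2 + ‖h (k + 1) - h k‖ ^ 2 ≤
      (1 - c) ^ (k + 1) * ‖z 0 - zs‖ ^ 2 := by
    induction k with
    | zero =>
      have hd := hlip 1 0
      have h1 : z 1 - z 0 = -h 0 := by rw [hz1]; module
      have hw : z 1 - zs + h 0 = z 0 - zs := by rw [hz1]; module
      have hs := shifted 0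
      simp only [zero_add] at hs ⊢
      rw [h1, norm_neg] at hd
      rw [hw] at hs
      nlinarith [sq_nonneg ‖h 0‖]
    | succ k ih =>
      have hd := hlip (k + 2) (k + 1)
      have h1 : z (k + 2) - z (k + 1) = -(h (k + 1) + (h (k + 1) - h k)) := by
        rw [hz]; module
      rw [h1, norm_neg] at hd
      have hs := shifted (k + 1)
      have h2 := norm_sq_add_le_two_mul (h (k + 1)) (h (k + 1) - h k)
      have h3 := mul_le_mul_of_nonneg_left ih (by linarith : 0 ≤ 1 - c)
      rw [pow_succ (1 - c) (k + 1)]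
      simp only [add_assoc, Nat.reduceAdd] at hs hd h2 h3 ⊢
      nlinarith [sq_nonneg ‖h (k + 1)‖, sq_nonneg ‖h (k + 1) - h k‖]
  have split (k : ℕ) : ‖z (k + 1) - zs‖ ^ 2 ≤
      2 * ‖z (k + 1) - zs + h k‖ ^ 2 + 1 / 8 * ‖z k - zs‖ ^ 2 := by
    have h1 := norm_sq_add_le_two_mul (z (k + 1) - zs + h k) (-h k)
    rw [add_neg_cancel_right, norm_neg] at h1
    linarith [hbound k]
  induction k with
  | zero =>
    have hw : z 1 - zs + h 0 = z 0 - zs := by rw [hz1]; module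
    have hs := split 0
    rw [zero_add, hw] at hs
    rw [zero_add, pow_zero]
    nlinarith [sq_nonneg ‖z 0 - zs‖]
  | succ k ih =>
    have hs := split (k + 1)
    have hl := lyapunov k
    have hp : 0 ≤ (1 - c) ^ k * ‖z 0 - zs‖ ^ 2 :=
      mul_nonneg (pow_nonneg (by linarith) k) (sq_nonneg _)
    rw [pow_succ (1 - c) k] at hl ⊢
    simp only [add_assoc, Nat.reduceAdd] at hs hl ⊢
    nlinarith [sq_nonneg ‖h (k + 1) - h k‖]

end OptimisticGradient

theorem gradient_eq_zero_of_forall_le {E : Type*} [NormedAddCommGroup E] [InnerProductSpace ℝ E]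
    [CompleteSpace E] {φ : E → ℝ} {a : E} (h : ∀ u, φ a ≤ φ u) : gradient φ a = 0 := by
  have hmin : IsLocalMin φ a := Filter.Eventually.of_forall h
  rw [gradient, hmin.fderiv_eq_zero, map_zero]

theorem gradient_eq_zero_of_forall_ge {E : Type*} [NormedAddCommGroup E] [InnerProductSpace ℝ E]
    [CompleteSpace E] {φ : E → ℝ} {a : E} (h : ∀ u, φ u ≤ φ a) : gradient φ a = 0 := by
  have hmax : IsLocalMax φ a := Filter.Eventually.of_forall h
  rw [gradient, hmax.fderiv_eq_zero, map_zero]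

/-- Linear convergence of OGDA with stepsize `η = 1/(4L)` for a smooth
`μ`-strongly convex–`μ`-strongly concave saddle point problem whose saddle operator
`G(x,y) = (∇_x f(x,y), −∇_y f(x,y))` is `L`-Lipschitz (in the product Euclidean norm):
with `r_j = ‖x_j − x*‖² + ‖y_j − y*‖²`, for all `k ≥ 0`,
`r_{k+1} ≤ (1 − μ/(4L))^k · 1024 (L/μ)² · r_0`. -/
theorem ogda_strongly_convex_concave_convergence (m n : ℕ) (μ L η : ℝ)
    (hμ : 0 < μ) (hμL : μ ≤ L) (hη : η = 1 / (4 * L))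
    (f : EuclideanSpace ℝ (Fin m) → EuclideanSpace ℝ (Fin n) → ℝ)
    (hdx : ∀ y, Differentiable ℝ (fun x => f x y))
    (hdy : ∀ x, Differentiable ℝ (fun y => f x y))
    (hconv : ∀ x x' y, f x y + ⟪gradient (fun u => f u y) x, x' - x⟫
      + μ / 2 * ‖x' - x‖ ^ 2 ≤ f x' y)
    (hconc : ∀ x y y', -f x y + ⟪-(gradient (fun v => f x v) y), y' - y⟫
      + μ / 2 * ‖y' - y‖ ^ 2 ≤ -f x y')
    (hLip : ∀ x x' y y',
      ‖gradient (fun u => f u y) x - gradient (fun u => f u y') x'‖ ^ 2 +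
        ‖gradient (fun v => f x v) y - gradient (fun v => f x' v) y'‖ ^ 2 ≤
      L ^ 2 * (‖x - x'‖ ^ 2 + ‖y - y'‖ ^ 2))
    (xs : EuclideanSpace ℝ (Fin m)) (ys : EuclideanSpace ℝ (Fin n))
    (hsaddle : ∀ x y, f xs y ≤ f xs ys ∧ f xs ys ≤ f x ys)
    (x : ℕ → EuclideanSpace ℝ (Fin m)) (y : ℕ → EuclideanSpace ℝ (Fin n))
    (hx1 : x 1 = x 0 - η • gradient (fun u => f u (y 0)) (x 0))
    (hy1 : y 1 = y 0 + η • gradient (fun v => f (x 0) v) (y 0))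
    (hx : ∀ k, 1 ≤ k → x (k + 1) = x k - (2 * η) • gradient (fun u => f u (y k)) (x k)
      + η • gradient (fun u => f u (y (k - 1))) (x (k - 1)))
    (hy : ∀ k, 1 ≤ k → y (k + 1) = y k + (2 * η) • gradient (fun v => f (x k) v) (y k)
      - η • gradient (fun v => f (x (k - 1)) v) (y (k - 1)))
    (r : ℕ → ℝ) (hr : ∀ j, r j = ‖x j - xs‖ ^ 2 + ‖y j - ys‖ ^ 2) :
    ∀ k : ℕ, r (k + 1) ≤ (1 - μ / (4 * L)) ^ k * (1024 * (L / μ) ^ 2) * r 0 := by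
  have hL : 0 < L := hμ.trans_le hμL
  have hη0 : 0 < η := by rw [hη]; positivity
  have hηL : η ^ 2 * L ^ 2 = 1 / 16 := by rw [hη]; field_simp; norm_num
  have hgx : gradient (fun u => f u ys) xs = 0 :=
    gradient_eq_zero_of_forall_le fun u => (hsaddle u ys).2
  have hgy : gradient (fun v => f xs v) ys = 0 :=
    gradient_eq_zero_of_forall_ge fun v => (hsaddle xs v).1
  let gx : ℕ → EuclideanSpace ℝ (Fin m) := fun k => gradient (fun u => f u (y k)) (x k)
  let gy : ℕ → EuclideanSpace ℝ (Fin n) := fun k => gradient (fun v => f (x k) v) (y k)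
  let z : ℕ → WithLp 2 (EuclideanSpace ℝ (Fin m) × EuclideanSpace ℝ (Fin n)) :=
    fun k => WithLp.toLp 2 (x k, y k)
  let zs : WithLp 2 (EuclideanSpace ℝ (Fin m) × EuclideanSpace ℝ (Fin n)) := WithLp.toLp 2 (xs, ys)
  let h : ℕ → WithLp 2 (EuclideanSpace ℝ (Fin m) × EuclideanSpace ℝ (Fin n)) :=
    fun k => WithLp.toLp 2 (η • gx k, -(η • gy k))
  have hrz (k : ℕ) : ‖z k - zs‖ ^ 2 = r k := by
    rw [hr, WithLp.prod_norm_sq_eq_of_L2]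
    rfl
  have hmono (k : ℕ) : η * μ * ‖z k - zs‖ ^ 2 ≤ ⟪h k, z k - zs⟫ := by
    have hinner : ⟪h k, z k - zs⟫ = η * (⟪gx k, x k - xs⟫ - ⟪gy k, y k - ys⟫) := by
      rw [WithLp.prod_inner_apply]
      change ⟪η • gx k, x k - xs⟫ + ⟪-(η • gy k), y k - ys⟫ = _
      rw [inner_neg_left, real_inner_smul_left, real_inner_smul_left]
      ring
    rw [hinner, hrz, hr, mul_assoc]
    refine mul_le_mul_of_nonneg_left ?_ hη0.le
    have h1 := hconv (x k) xs (y k)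
    have h2 := hconc (x k) (y k) ys
    have h3 := hconv xs (x k) ys
    have h4 := hconc xs ys (y k)
    rw [hgx, inner_zero_left] at h3
    rw [hgy, neg_zero, inner_zero_left] at h4
    rw [← neg_sub (x k) xs, inner_neg_right, norm_neg] at h1
    rw [← neg_sub (y k) ys, inner_neg_right, inner_neg_left, norm_neg] at h2
    linarith
  have hlip (j k : ℕ) : ‖h j - h k‖ ^ 2 ≤ 1 / 16 * ‖z j - z k‖ ^ 2 := by
    have hh : ‖h j - h k‖ ^ 2 = η ^ 2 * (‖gx j - gx k‖ ^ 2 + ‖gy j - gy k‖ ^ 2) := by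
      rw [WithLp.prod_norm_sq_eq_of_L2]
      change ‖η • gx j - η • gx k‖ ^ 2 + ‖-(η • gy j) - -(η • gy k)‖ ^ 2 = _
      rw [← neg_sub', norm_neg, ← smul_sub, ← smul_sub, norm_smul, norm_smul, mul_pow, mul_pow,
        Real.norm_eq_abs, sq_abs]
      ring
    have hzz : ‖z j - z k‖ ^ 2 = ‖x j - x k‖ ^ 2 + ‖y j - y k‖ ^ 2 := by
      rw [WithLp.prod_norm_sq_eq_of_L2]
      rfl
    rw [hh, hzz, ← hηL, mul_assoc]
    exact mul_le_mul_of_nonneg_left (hLip (x j) (x k) (y j) (y k)) (sq_nonneg η)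
  have hbound (k : ℕ) : ‖h k‖ ^ 2 ≤ 1 / 16 * ‖z k - zs‖ ^ 2 := by
    have hh : ‖h k‖ ^ 2 = η ^ 2 * (‖gx k‖ ^ 2 + ‖gy k‖ ^ 2) := by
      rw [WithLp.prod_norm_sq_eq_of_L2]
      change ‖η • gx k‖ ^ 2 + ‖-(η • gy k)‖ ^ 2 = _
      rw [norm_neg, norm_smul, norm_smul, mul_pow, mul_pow, Real.norm_eq_abs, sq_abs]
      ring
    have hg := hLip (x k) xs (y k) ys
    rw [hgx, hgy, sub_zero, sub_zero] at hg
    rw [hh, hrz, hr, ← hηL, mul_assoc]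
    exact mul_le_mul_of_nonneg_left hg (sq_nonneg η)
  have hz1 : z 1 = z 0 - h 0 := by
    change WithLp.toLp 2 (x 1, y 1) = WithLp.toLp 2 (x 0 - η • gx 0, y 0 - -(η • gy 0))
    rw [hx1, hy1, sub_neg_eq_add]
  have hz (k : ℕ) : z (k + 2) = z (k + 1) - (2 : ℝ) • h (k + 1) + h k := by
    change WithLp.toLp 2 (x (k + 2), y (k + 2)) =
      WithLp.toLp 2 (x (k + 1) - (2 : ℝ) • η • gx (k + 1) + η • gx k,
        y (k + 1) - (2 : ℝ) • -(η • gy (k + 1)) + -(η • gy k))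
    rw [hx (k + 1) k.succ_pos, hy (k + 1) k.succ_pos]
    simp only [Nat.add_sub_cancel]
    congr 2
    · module
    · module
  intro k
  have hc : η * μ = μ / (4 * L) := by rw [hη]; ring
  have hc' : μ / (4 * L) ≤ 1 / 4 := by
    rw [div_le_div_iff₀ (by positivity) (by norm_num)]
    linarith
  have hmain := optimistic_gradient_linear_convergence_s9 (by positivity) (hc ▸ hc') hmono hlip hbound
    hz1 hz k
  rw [hrz, hrz, hc] at hmain
  have hr0 : 0 ≤ r 0 := by rw [hr]; positivity
  have hratio : 1 ≤ (L / μ) ^ 2 := one_le_pow₀ ((one_le_div hμ).2 hμL)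
  have hp : 0 ≤ (1 - μ / (4 * L)) ^ k := pow_nonneg (by linarith) k
  calc r (k + 1) ≤ 4 * (1 - μ / (4 * L)) ^ k * r 0 := hmain
    _ = (1 - μ / (4 * L)) ^ k * 4 * r 0 := by ring
    _ ≤ (1 - μ / (4 * L)) ^ k * (1024 * (L / μ) ^ 2) * r 0 := by
      gcongr
      linarith
end

section
/- Let (H, ⟪·,·⟫) be a real inner product space, let μ, L > 0, and let F : H → H be L-Lipschitz and μ-strongly monotone with F(z*) = 0 for some z* ∈ H. Let η > 0, and given z ∈ H define the extra-gradient step z_{1/2} = z − ηF(z) and z⁺ = z − ηF(z_{1/2}). Then ‖z⁺ − z*‖² ≤ (1 − ημ)‖z − z*‖² + (η²L² + 2ημ − 1)‖z − z_{1/2}‖². -/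
open RealInnerProductSpace

/-- One step of the extra-gradient method, `z_{1/2} = z − ηF(z)`,
`z⁺ = z − ηF(z_{1/2})`, for an `L`-Lipschitz, `μ`-strongly monotone operator `F` with
zero `z*`, satisfies
`‖z⁺ − z*‖² ≤ (1 − ημ)‖z − z*‖² + (η²L² + 2ημ − 1)‖z − z_{1/2}‖²`. -/
theorem eg_one_step_estimate (H : Type*) [NormedAddCommGroup H] [InnerProductSpace ℝ H]
    (μ L η : ℝ) (hμ : 0 < μ) (hL : 0 < L) (hη : 0 < η)
    (F : H → H)
    (hLip : ∀ z w : H, ‖F z - F w‖ ≤ L * ‖z - w‖)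
    (hmono : ∀ z w : H, μ * ‖z - w‖ ^ 2 ≤ ⟪F z - F w, z - w⟫)
    (zs : H) (hzs : F zs = 0)
    (z zhalf zp : H)
    (hhalf : zhalf = z - η • F z)
    (hplus : zp = z - η • F zhalf) :
    ‖zp - zs‖ ^ 2 ≤ (1 - η * μ) * ‖z - zs‖ ^ 2
      + (η ^ 2 * L ^ 2 + 2 * η * μ - 1) * ‖z - zhalf‖ ^ 2 := by
  have hstep : z - zhalf = η • F z := by rw [hhalf]; abel
  have hmono' : μ * ‖zhalf - zs‖ ^ 2 ≤ ⟪F zhalf, zhalf - zs⟫ := by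
    simpa [hzs] using hmono zhalf zs
  have hLip' : ‖F zhalf - F z‖ ^ 2 ≤ L ^ 2 * ‖z - zhalf‖ ^ 2 := by
    rw [← mul_pow, norm_sub_rev z zhalf]
    exact pow_le_pow_left₀ (norm_nonneg _) (hLip zhalf z) 2
  have hpar : ‖z - zs‖ ^ 2 ≤ 2 * ‖zhalf - zs‖ ^ 2 + 2 * ‖z - zhalf‖ ^ 2 := by
    have h := parallelogram_law_with_norm ℝ (zhalf - zs) (z - zhalf)
    rw [show zhalf - zs + (z - zhalf) = z - zs by abel] at h
    nlinarith [sq_nonneg ‖zhalf - zs - (z - zhalf)‖]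
  have hexpand : ‖zp - zs‖ ^ 2 = ‖z - zs‖ ^ 2 - 2 * η * ⟪F zhalf, zhalf - zs⟫
      + η ^ 2 * ‖F zhalf - F z‖ ^ 2 - ‖z - zhalf‖ ^ 2 := by
    have hp : zp - zs = (z - zs) - η • F zhalf := by rw [hplus]; abel
    have hh : zhalf - zs = (z - zs) - η • F z := by rw [hhalf]; abel
    rw [hstep, hp, hh, norm_sub_sq_real, norm_sub_sq_real (F zhalf), norm_smul, norm_smul,
      mul_pow, mul_pow, Real.norm_eq_abs, sq_abs, inner_sub_right, real_inner_smul_right,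
      real_inner_smul_right, real_inner_comm]
    ring
  rw [hexpand]
  linarith [mul_le_mul_of_nonneg_left hmono' hη.le,
    mul_le_mul_of_nonneg_left hLip' (sq_nonneg η),
    mul_le_mul_of_nonneg_left hpar (mul_pos hη hμ).le]
end

section
/- Let f : ℝ^m × ℝ^n → ℝ be differentiable, μ-strongly convex in x for every fixed y and μ-strongly concave in y for every fixed x, with saddle point (x*, y*), and suppose the map G(x,y) = (∇_x f(x,y), −∇_y f(x,y)) on ℝ^m × ℝ^n is L-Lipschitz, where 0 < μ ≤ L. Set η = 1/(4L). Given (x, y), define the extra-gradient step: x_{1/2} = x − η∇_x f(x,y), y_{1/2} = y + η∇_y f(x,y), x⁺ = x − η∇_x f(x_{1/2}, y_{1/2}), y⁺ = y + η∇_y f(x_{1/2}, y_{1/2}). Then ‖x⁺ − x*‖² + ‖y⁺ − y*‖² ≤ (1 − μ/(4L)) (‖x − x*‖² + ‖y − y*‖²). -/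
open RealInnerProductSpace

section InnerProductSpace

variable {E : Type*} [NormedAddCommGroup E] [InnerProductSpace ℝ E]

/-- The exact change of the squared distance to `s` under an extra-gradient step from `u` with
midpoint `w = u - η • a`, where `a` and `c` are the directions used at `u` and at `w`. -/
theorem norm_sq_extragradient_step (u a c s : E) (η : ℝ) :
    ‖u - η • c - s‖ ^ 2 = ‖u - s‖ ^ 2 - 2 * η * ⟪c, u - η • a - s⟫
      + η ^ 2 * ‖a - c‖ ^ 2 - ‖u - (u - η • a)‖ ^ 2 := by
  have h₁ : u - η • c - s = (u - s) - η • c := by abel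
  have h₂ : u - η • a - s = (u - s) - η • a := by abel
  have h₃ : u - (u - η • a) = η • a := by abel
  rw [h₁, h₂, h₃, norm_sub_sq_real, norm_sub_sq_real a c, inner_sub_right c]
  simp only [inner_smul_right, norm_smul, mul_pow, Real.norm_eq_abs, sq_abs]
  rw [real_inner_comm c (u - s), real_inner_comm c a]
  ring

theorem norm_sub_sq_le_two_mul_add (u w s : E) :
    ‖u - s‖ ^ 2 ≤ 2 * ‖w - s‖ ^ 2 + 2 * ‖u - w‖ ^ 2 := by
  have h := parallelogram_law_with_norm ℝ (u - w) (w - s)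
  rw [sub_add_sub_cancel] at h
  nlinarith [sq_nonneg ‖u - w - (w - s)‖]

theorem gradient_eq_zero_of_forall_le_s12 [CompleteSpace E] {g : E → ℝ} {s : E}
    (h : ∀ v, g s ≤ g v) : gradient g s = 0 := by
  have h₀ : IsLocalMin g s := Filter.Eventually.of_forall h
  simp [gradient, h₀.fderiv_eq_zero]

theorem gradient_eq_zero_of_forall_ge_s12 [CompleteSpace E] {g : E → ℝ} {s : E}
    (h : ∀ v, g v ≤ g s) : gradient g s = 0 := by
  have h₀ : IsLocalMax g s := Filter.Eventually.of_forall h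
  simp [gradient, h₀.fderiv_eq_zero]

end InnerProductSpace

/-- One step of the extra-gradient method with stepsize `η = 1/(4L)`
for a smooth `μ`-strongly convex–`μ`-strongly concave saddle point problem whose saddle
operator `G(x,y) = (∇_x f(x,y), −∇_y f(x,y))` is `L`-Lipschitz (product Euclidean norm)
contracts the squared distance to the saddle point by the factor `1 − μ/(4L)`. -/
theorem eg_strongly_convex_concave_step (m n : ℕ) (μ L η : ℝ)
    (hμ : 0 < μ) (hμL : μ ≤ L) (hη : η = 1 / (4 * L))
    (f : EuclideanSpace ℝ (Fin m) → EuclideanSpace ℝ (Fin n) → ℝ)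
    (hdx : ∀ y, Differentiable ℝ (fun x => f x y))
    (hdy : ∀ x, Differentiable ℝ (fun y => f x y))
    (hconv : ∀ x x' y, f x y + ⟪gradient (fun u => f u y) x, x' - x⟫
      + μ / 2 * ‖x' - x‖ ^ 2 ≤ f x' y)
    (hconc : ∀ x y y', -f x y + ⟪-(gradient (fun v => f x v) y), y' - y⟫
      + μ / 2 * ‖y' - y‖ ^ 2 ≤ -f x y')
    (hLip : ∀ x x' y y',
      ‖gradient (fun u => f u y) x - gradient (fun u => f u y') x'‖ ^ 2 +
        ‖gradient (fun v => f x v) y - gradient (fun v => f x' v) y'‖ ^ 2 ≤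
      L ^ 2 * (‖x - x'‖ ^ 2 + ‖y - y'‖ ^ 2))
    (xs : EuclideanSpace ℝ (Fin m)) (ys : EuclideanSpace ℝ (Fin n))
    (hsaddle : ∀ x y, f xs y ≤ f xs ys ∧ f xs ys ≤ f x ys)
    (x xhalf xp : EuclideanSpace ℝ (Fin m)) (y yhalf yp : EuclideanSpace ℝ (Fin n))
    (hxhalf : xhalf = x - η • gradient (fun u => f u y) x)
    (hyhalf : yhalf = y + η • gradient (fun v => f x v) y)
    (hxp : xp = x - η • gradient (fun u => f u yhalf) xhalf)
    (hyp : yp = y + η • gradient (fun v => f xhalf v) yhalf) :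
    ‖xp - xs‖ ^ 2 + ‖yp - ys‖ ^ 2 ≤
      (1 - μ / (4 * L)) * (‖x - xs‖ ^ 2 + ‖y - ys‖ ^ 2) := by
  have hL : 0 < L := hμ.trans_le hμL
  have hη₀ : 0 < η := by rw [hη]; positivity
  have hηL : η * L = 1 / 4 := by rw [hη]; field_simp
  have hημ : η * μ ≤ 1 / 4 := hηL ▸ mul_le_mul_of_nonneg_left hμL hη₀.le
  have hrate : μ / (4 * L) = η * μ := by rw [hη]; ring
  have hgx : gradient (fun u => f u ys) xs = 0 :=
    gradient_eq_zero_of_forall_le_s12 fun v => (hsaddle v ys).2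
  have hgy : gradient (fun v => f xs v) ys = 0 :=
    gradient_eq_zero_of_forall_ge_s12 fun v => (hsaddle xs v).1
  have hx₁ := hconv xs xhalf ys
  have hy₁ := hconc xs ys yhalf
  rw [hgx, inner_zero_left] at hx₁
  rw [hgy, neg_zero, inner_zero_left] at hy₁
  have hx₂ := hconv xhalf xs yhalf
  have hy₂ := hconc xhalf yhalf ys
  have hlip := hLip x xhalf y yhalf
  have hx₃ := norm_sub_sq_le_two_mul_add x xhalf xs
  have hy₃ := norm_sub_sq_le_two_mul_add y yhalf ys
  have hx₄ := norm_sq_extragradient_step x (gradient (fun u => f u y) x)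
    (gradient (fun u => f u yhalf) xhalf) xs η
  have hy₄ := norm_sq_extragradient_step y (-gradient (fun v => f x v) y)
    (-gradient (fun v => f xhalf v) yhalf) ys η
  rw [← hxhalf, ← hxp] at hx₄
  rw [smul_neg, smul_neg, sub_neg_eq_add, sub_neg_eq_add, ← hyhalf, ← hyp,
    neg_sub_neg, norm_sub_rev (gradient (fun v => f xhalf v) yhalf)] at hy₄
  rw [← neg_sub xhalf xs, inner_neg_right, norm_neg] at hx₂
  rw [← neg_sub yhalf ys, inner_neg_right, norm_neg] at hy₂
  have hmono : μ * (‖xhalf - xs‖ ^ 2 + ‖yhalf - ys‖ ^ 2) ≤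
      ⟪gradient (fun u => f u yhalf) xhalf, xhalf - xs⟫ +
        ⟪-gradient (fun v => f xhalf v) yhalf, yhalf - ys⟫ := by
    linarith
  have hmono' := mul_le_mul_of_nonneg_left hmono hη₀.le
  have hlip' := mul_le_mul_of_nonneg_left hlip (sq_nonneg η)
  rw [← mul_assoc, ← mul_pow, hηL] at hlip'
  have hdist := mul_le_mul_of_nonneg_left (add_le_add hx₃ hy₃) (mul_pos hη₀ hμ).le
  have hstep := mul_le_mul_of_nonneg_right hημ
    (add_nonneg (sq_nonneg ‖x - xhalf‖) (sq_nonneg ‖y - yhalf‖))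
  have hpos := add_nonneg (sq_nonneg ‖x - xhalf‖) (sq_nonneg ‖y - yhalf‖)
  rw [hrate, hx₄, hy₄]
  linarith
end

section
/- Let B be a real d×d matrix, Λ > 0 satisfy ‖Bᵀv‖² ≤ Λ‖v‖² for all v ∈ ℝ^d, and let η be a real number with η²Λ < 1. Then for all v ∈ ℝ^d, ‖(I − η²BBᵀ − (I + η²BBᵀ)⁻¹) v‖ ≤ (η⁴Λ²/(1 − η²Λ)) ‖v‖. -/
open Matrix

theorem inner_toEuclideanLin_left {d : ℕ} (B : Matrix (Fin d) (Fin d) ℝ)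
    (x y : EuclideanSpace ℝ (Fin d)) :
    inner ℝ (Matrix.toEuclideanLin B x) y = inner ℝ x (Matrix.toEuclideanLin Bᵀ y) := by
  rw [← Matrix.conjTranspose_eq_transpose_of_trivial,
    Matrix.toEuclideanLin_conjTranspose_eq_adjoint, LinearMap.adjoint_inner_right]

theorem toEuclideanLin_mul_apply {d : ℕ} (A B : Matrix (Fin d) (Fin d) ℝ)
    (v : EuclideanSpace ℝ (Fin d)) :
    Matrix.toEuclideanLin (A * B) v = Matrix.toEuclideanLin A (Matrix.toEuclideanLin B v) := by
  simp [Matrix.toLpLin_apply]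

/-- A bound on `‖Bᵀv‖²` gives the corresponding bound on `‖BBᵀv‖`. -/
theorem norm_mul_transpose_le {d : ℕ} (B : Matrix (Fin d) (Fin d) ℝ) {Λ : ℝ} (hΛ : 0 ≤ Λ)
    (hBt : ∀ v : EuclideanSpace ℝ (Fin d), ‖Matrix.toEuclideanLin Bᵀ v‖ ^ 2 ≤ Λ * ‖v‖ ^ 2)
    (v : EuclideanSpace ℝ (Fin d)) :
    ‖Matrix.toEuclideanLin (B * Bᵀ) v‖ ≤ Λ * ‖v‖ := by
  have hsqrt (u : EuclideanSpace ℝ (Fin d)) :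
      ‖Matrix.toEuclideanLin Bᵀ u‖ ≤ √Λ * ‖u‖ := by
    refine le_of_sq_le_sq ?_ (by positivity)
    rw [mul_pow, Real.sq_sqrt hΛ]
    exact hBt u
  set z := Matrix.toEuclideanLin (B * Bᵀ) v with hz
  have h : ‖z‖ * ‖z‖ ≤ Λ * ‖v‖ * ‖z‖ := calc
    ‖z‖ * ‖z‖ = inner ℝ (Matrix.toEuclideanLin Bᵀ v) (Matrix.toEuclideanLin Bᵀ z) := by
      rw [← inner_toEuclideanLin_left, ← toEuclideanLin_mul_apply, ← hz,
        real_inner_self_eq_norm_mul_norm]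
    _ ≤ ‖Matrix.toEuclideanLin Bᵀ v‖ * ‖Matrix.toEuclideanLin Bᵀ z‖ := real_inner_le_norm _ _
    _ ≤ (√Λ * ‖v‖) * (√Λ * ‖z‖) := by gcongr <;> exact hsqrt _
    _ = √Λ * √Λ * ‖v‖ * ‖z‖ := by ring
    _ = Λ * ‖v‖ * ‖z‖ := by rw [Real.mul_self_sqrt hΛ]
  rcases (norm_nonneg z).eq_or_lt with h0 | h0
  · rw [← h0]; positivity
  · exact le_of_mul_le_mul_right h h0

/-- `I + cBBᵀ` does not decrease norms when `c ≥ 0`. -/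
theorem norm_le_norm_one_add_smul_mul_transpose {d : ℕ} (B : Matrix (Fin d) (Fin d) ℝ) {c : ℝ}
    (hc : 0 ≤ c) (w : EuclideanSpace ℝ (Fin d)) :
    ‖w‖ ≤ ‖Matrix.toEuclideanLin (1 + c • (B * Bᵀ)) w‖ := by
  have h : ‖w‖ * ‖w‖ ≤ ‖w‖ * ‖Matrix.toEuclideanLin (1 + c • (B * Bᵀ)) w‖ := by
    refine le_trans ?_ (real_inner_le_norm _ _)
    have h1 : Matrix.toEuclideanLin (1 + c • (B * Bᵀ)) w
        = w + c • Matrix.toEuclideanLin B (Matrix.toEuclideanLin Bᵀ w) := by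
      rw [← toEuclideanLin_mul_apply]
      simp
    rw [h1, inner_add_right, real_inner_smul_right,
      real_inner_comm (Matrix.toEuclideanLin B _) w, inner_toEuclideanLin_left, real_inner_self_eq_norm_mul_norm,
      real_inner_self_eq_norm_mul_norm]
    have := mul_nonneg hc (mul_self_nonneg ‖Matrix.toEuclideanLin Bᵀ w‖)
    linarith
  rcases (norm_nonneg w).eq_or_lt with h0 | h0
  · rw [← h0]; positivity
  · exact le_of_mul_le_mul_left h h0

theorem isUnit_det_one_add_smul_mul_transpose {d : ℕ} (B : Matrix (Fin d) (Fin d) ℝ) {c : ℝ}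
    (hc : 0 ≤ c) : IsUnit (1 + c • (B * Bᵀ)).det := by
  have h : (B * Bᵀ).PosSemidef := by
    simpa [Matrix.conjTranspose_eq_transpose_of_trivial] using
      Matrix.posSemidef_self_mul_conjTranspose B
  exact (Matrix.isUnit_iff_isUnit_det _).1 (Matrix.PosDef.one.add_posSemidef (h.smul hc)).isUnit

theorem one_sub_sub_inv_one_add {d : ℕ} {M : Matrix (Fin d) (Fin d) ℝ}
    (h : IsUnit (1 + M).det) : 1 - M - (1 + M)⁻¹ = -(M * (M * (1 + M)⁻¹)) := by
  have h1 := Matrix.mul_nonsing_inv _ h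
  calc 1 - M - (1 + M)⁻¹ = (1 - M) * ((1 + M) * (1 + M)⁻¹) - (1 + M)⁻¹ := by rw [h1, mul_one]
    _ = -(M * (M * (1 + M)⁻¹)) := by noncomm_ring

/-- Norm bound on the Neumann-truncation error matrix
`E_x = I − η²BBᵀ − (I + η²BBᵀ)⁻¹`: if `‖Bᵀv‖² ≤ Λ‖v‖²` for all `v` (so `Λ` upper-bounds
`λ_max(BBᵀ)`) and `η²Λ < 1`, then `‖E_x v‖ ≤ (η⁴Λ²/(1 − η²Λ)) ‖v‖` for all `v`. -/
theorem error_matrix_norm_bound (d : ℕ) (B : Matrix (Fin d) (Fin d) ℝ) (Λ η : ℝ)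
    (hΛ : 0 < Λ)
    (hBt : ∀ v : EuclideanSpace ℝ (Fin d), ‖Matrix.toEuclideanLin Bᵀ v‖ ^ 2 ≤ Λ * ‖v‖ ^ 2)
    (hη : η ^ 2 * Λ < 1) :
    ∀ v : EuclideanSpace ℝ (Fin d),
      ‖Matrix.toEuclideanLin (1 - η ^ 2 • (B * Bᵀ) - (1 + η ^ 2 • (B * Bᵀ))⁻¹) v‖ ≤
        η ^ 4 * Λ ^ 2 / (1 - η ^ 2 * Λ) * ‖v‖ := by
  intro v
  have hdet := isUnit_det_one_add_smul_mul_transpose B (sq_nonneg η)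
  have hM (u : EuclideanSpace ℝ (Fin d)) :
      ‖Matrix.toEuclideanLin (η ^ 2 • (B * Bᵀ)) u‖ ≤ η ^ 2 * Λ * ‖u‖ := by
    rw [map_smul, LinearMap.smul_apply, norm_smul, Real.norm_of_nonneg (sq_nonneg η), mul_assoc]
    gcongr
    exact norm_mul_transpose_le B hΛ.le hBt u
  have hw : ‖Matrix.toEuclideanLin (1 + η ^ 2 • (B * Bᵀ))⁻¹ v‖ ≤ ‖v‖ := by
    refine (norm_le_norm_one_add_smul_mul_transpose B (sq_nonneg η) _).trans_eq ?_
    rw [← toEuclideanLin_mul_apply, Matrix.mul_nonsing_inv _ hdet]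
    simp
  rw [one_sub_sub_inv_one_add hdet, map_neg, LinearMap.neg_apply, norm_neg,
    toEuclideanLin_mul_apply, toEuclideanLin_mul_apply]
  calc _ ≤ η ^ 2 * Λ * (η ^ 2 * Λ * ‖v‖) := by
        refine (hM _).trans ?_
        gcongr
        refine (hM _).trans ?_
        gcongr
    _ = η ^ 4 * Λ ^ 2 * ‖v‖ := by ring
    _ ≤ η ^ 4 * Λ ^ 2 / (1 - η ^ 2 * Λ) * ‖v‖ := by
        gcongr
        exact le_div_self (by positivity) (by linarith) (by nlinarith [sq_nonneg η])
end

section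
/- Let B be a real d×d matrix and x, y ∈ ℝ^d fixed. For η > 0 define the extra-gradient point e(η) = (x − ηBy − η²BBᵀx, y + ηBᵀx − η²BᵀBy) and the proximal point p(η) = ((I + η²BBᵀ)⁻¹(x − ηBy), (I + η²BᵀB)⁻¹(y + ηBᵀx)) in ℝ^d × ℝ^d. Then ‖e(η) − p(η)‖/η² → 0 as η → 0⁺. -/
open Matrix Filter

/-- Truncating the Neumann series of `(1 + η² A)⁻¹` after its linear term and applying it to
`x + η u` only costs `o(η²)`, even when the term `η³ A u` is dropped. -/
theorem tendsto_truncated_resolvent_sub_resolvent {n : Type*} [Fintype n] [DecidableEq n]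
    (A : Matrix n n ℝ) (x u : EuclideanSpace ℝ n) :
    Tendsto (fun η : ℝ => (η ^ 2)⁻¹ • (x + η • u - η ^ 2 • Matrix.toEuclideanLin A x
        - Matrix.toEuclideanLin ((1 + η ^ 2 • A)⁻¹) (x + η • u)))
      (nhdsWithin 0 (Set.Ioi 0)) (nhds 0) := by
  have hM : Continuous fun η : ℝ => 1 + η ^ 2 • A := by fun_prop
  have hdet : ∀ᶠ η : ℝ in nhdsWithin 0 (Set.Ioi 0), (1 + η ^ 2 • A).det ≠ 0 :=
    nhdsWithin_le_nhds (hM.matrix_det.continuousAt.eventually_ne (by simp))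
  have hinv : ContinuousAt (fun η : ℝ => (1 + η ^ 2 • A)⁻¹) 0 := by
    simp only [Matrix.inv_def, Ring.inverse_eq_inv']
    exact (hM.matrix_det.continuousAt.inv₀ (by simp)).smul hM.matrix_adjugate.continuousAt
  have hlim : ContinuousAt (fun η : ℝ => Matrix.toEuclideanLin ((1 + η ^ 2 • A)⁻¹ * A) (x + η • u)
      - Matrix.toEuclideanLin A x) 0 := by
    simp only [Matrix.toLpLin_apply]
    refine ContinuousAt.sub ?_ continuousAt_const
    refine (PiLp.continuous_toLp 2 _).continuousAt.comp ?_
    have hmul : ContinuousAt (fun η : ℝ => (1 + η ^ 2 • A)⁻¹ * A) 0 := hinv.mul continuousAt_const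
    have hvec : ContinuousAt (fun η : ℝ => (x + η • u).ofLp) 0 := by fun_prop
    have hmulVec : Continuous fun p : Matrix n n ℝ × (n → ℝ) => p.1 *ᵥ p.2 :=
      continuous_fst.matrix_mulVec continuous_snd
    exact hmulVec.continuousAt.comp (hmul.prodMk hvec)
  have hzero := hlim.tendsto.mono_left (nhdsWithin_le_nhds (s := Set.Ioi 0))
  simp only [ne_eq, OfNat.ofNat_ne_zero, not_false_eq_true, zero_pow, zero_smul, add_zero,
    inv_one, one_mul, sub_self] at hzero
  refine hzero.congr' ?_
  filter_upwards [hdet, self_mem_nhdsWithin] with η hη hpos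
  have hne : η ^ 2 ≠ 0 := pow_ne_zero 2 (ne_of_gt hpos)
  have hresolvent : (1 + η ^ 2 • A)⁻¹ = 1 - η ^ 2 • ((1 + η ^ 2 • A)⁻¹ * A) := by
    have hcancel := Matrix.nonsing_inv_mul (1 + η ^ 2 • A) (isUnit_iff_ne_zero.mpr hη)
    rw [mul_add, mul_one, Matrix.mul_smul] at hcancel
    exact eq_sub_of_add_eq hcancel
  rw [eq_inv_smul_iff₀ hne]
  conv_rhs => rw [hresolvent]
  simp only [map_sub, map_smul, LinearMap.sub_apply, LinearMap.smul_apply, Matrix.toLpLin_one,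
    LinearMap.id_apply, smul_sub]
  abel

/-- The extra-gradient step approximates the proximal point step to
within `o(η²)` for the bilinear saddle point problem: with
`e(η) = (x − ηBy − η²BBᵀx, y + ηBᵀx − η²BᵀBy)` and
`p(η) = ((I + η²BBᵀ)⁻¹(x − ηBy), (I + η²BᵀB)⁻¹(y + ηBᵀx))`, one has
`‖e(η) − p(η)‖/η² → 0` as `η → 0⁺` (product Euclidean norm). -/
theorem eg_is_o_eta_sq_of_prox (d : ℕ) (B : Matrix (Fin d) (Fin d) ℝ)
    (x y : EuclideanSpace ℝ (Fin d))
    (ex ey px py : ℝ → EuclideanSpace ℝ (Fin d))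
    (hex : ∀ η : ℝ, ex η = x - η • Matrix.toEuclideanLin B y
      - η ^ 2 • Matrix.toEuclideanLin (B * Bᵀ) x)
    (hey : ∀ η : ℝ, ey η = y + η • Matrix.toEuclideanLin Bᵀ x
      - η ^ 2 • Matrix.toEuclideanLin (Bᵀ * B) y)
    (hpx : ∀ η : ℝ, px η = Matrix.toEuclideanLin ((1 + η ^ 2 • (B * Bᵀ))⁻¹)
      (x - η • Matrix.toEuclideanLin B y))
    (hpy : ∀ η : ℝ, py η = Matrix.toEuclideanLin ((1 + η ^ 2 • (Bᵀ * B))⁻¹)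
      (y + η • Matrix.toEuclideanLin Bᵀ x)) :
    Tendsto (fun η : ℝ => Real.sqrt (‖ex η - px η‖ ^ 2 + ‖ey η - py η‖ ^ 2) / η ^ 2)
      (nhdsWithin 0 (Set.Ioi 0)) (nhds 0) := by
  have hx := (tendsto_truncated_resolvent_sub_resolvent (B * Bᵀ) x
    (-Matrix.toEuclideanLin B y)).norm.pow 2
  have hy := (tendsto_truncated_resolvent_sub_resolvent (Bᵀ * B) y
    (Matrix.toEuclideanLin Bᵀ x)).norm.pow 2
  have h := (hx.add hy).sqrt
  simp only [norm_zero, ne_eq, OfNat.ofNat_ne_zero, not_false_eq_true, zero_pow, add_zero,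
    Real.sqrt_zero] at h
  refine h.congr fun η => ?_
  simp only [smul_neg, ← sub_eq_add_neg, ← hex, ← hey, ← hpx, ← hpy, norm_smul, mul_pow, ← mul_add]
  rw [Real.sqrt_mul (by positivity), Real.sqrt_sq (norm_nonneg _), Real.norm_of_nonneg
    (by positivity), div_eq_inv_mul]
end

section
/- Let B be a real d×d matrix, η a real number, and let (x_k, y_k) be sequences in ℝ^d satisfying the OGDA recursion x_{k+1} = x_k − 2ηB y_k + ηB y_{k−1} and y_{k+1} = y_k + 2ηBᵀ x_k − ηBᵀ x_{k−1} for all k ≥ 1. Then for every k ≥ 3, x_{k+1} = (I − η²BBᵀ)(x_k − ηB y_k) − η³BBᵀB (y_k + 2y_{k−1} − 3y_{k−2} + y_{k−3}) and y_{k+1} = (I − η²BᵀB)(y_k + ηBᵀ x_k) + η³BᵀBBᵀ (x_k + 2x_{k−1} − 3x_{k−2} + x_{k−3}). -/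
open Matrix

/-- Elimination of the intermediate iterates in a coupled pair of optimistic gradient recursions
with coupling matrices `B` and `C`. The recursion is symmetric under exchanging `x` with `y` and
`B` with `C` while negating `η`. -/
lemma optimistic_gradient_step_decomposition {m n : Type*} [Fintype m] [Fintype n]
    [DecidableEq m] (B : Matrix m n ℝ) (C : Matrix n m ℝ) (η : ℝ)
    (x : ℕ → m → ℝ) (y : ℕ → n → ℝ)
    (hx : ∀ k, 1 ≤ k → x (k + 1) = x k - (2 * η) • B *ᵥ y k + η • B *ᵥ y (k - 1))
    (hy : ∀ k, 1 ≤ k → y (k + 1) = y k + (2 * η) • C *ᵥ x k - η • C *ᵥ x (k - 1))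
    (k : ℕ) (hk : 3 ≤ k) :
    x (k + 1) = (1 - η ^ 2 • (B * C)) *ᵥ (x k - η • B *ᵥ y k)
      - η ^ 3 • (B * C * B) *ᵥ
          (y k + (2 : ℝ) • y (k - 1) - (3 : ℝ) • y (k - 2) + y (k - 3)) := by
  obtain ⟨j, rfl⟩ := Nat.exists_eq_add_of_le' hk
  have hx₁ := hx (j + 1) (by lia)
  have hx₂ := hx (j + 2) (by lia)
  have hx₃ := hx (j + 3) (by lia)
  have hy₂ := hy (j + 2) (by lia)
  simp only [Nat.add_sub_cancel, show j + 3 - 1 = j + 2 by lia, show j + 3 - 2 = j + 1 by lia,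
    show j + 2 - 1 = j + 1 by lia, show j + 1 + 1 = j + 2 by lia,
    show j + 2 + 1 = j + 3 by lia] at hx₁ hx₂ hx₃ hy₂ ⊢
  have hBy := congrArg (B *ᵥ ·) hy₂
  have hBCx₂ := congrArg (fun v => B *ᵥ C *ᵥ v) hx₁
  have hBCx₃ := congrArg (fun v => B *ᵥ C *ᵥ v) hx₂
  simp only [mulVec_add, mulVec_sub, mulVec_smul] at hBy hBCx₂ hBCx₃
  simp only [sub_mulVec, one_mulVec, smul_mulVec, ← mulVec_mulVec, mulVec_add, mulVec_sub,
    mulVec_smul]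
  linear_combination (norm := module) hx₃ - η • hBy + η ^ 2 • hBCx₃ - η ^ 2 • hBCx₂

/-- Exact rewriting of each OGDA step for the bilinear saddle point
problem as a Neumann-truncated proximal point step plus explicit cubic error terms:
for `k ≥ 3`,
`x_{k+1} = (I − η²BBᵀ)(x_k − ηBy_k) − η³BBᵀB(y_k + 2y_{k−1} − 3y_{k−2} + y_{k−3})` and
`y_{k+1} = (I − η²BᵀB)(y_k + ηBᵀx_k) + η³BᵀBBᵀ(x_k + 2x_{k−1} − 3x_{k−2} + x_{k−3})`. -/
theorem ogda_bilinear_exact_decomposition (d : ℕ) (B : Matrix (Fin d) (Fin d) ℝ) (η : ℝ)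
    (x y : ℕ → Fin d → ℝ)
    (hx : ∀ k, 1 ≤ k → x (k + 1) =
      x k - (2 * η) • B.mulVec (y k) + η • B.mulVec (y (k - 1)))
    (hy : ∀ k, 1 ≤ k → y (k + 1) =
      y k + (2 * η) • Bᵀ.mulVec (x k) - η • Bᵀ.mulVec (x (k - 1))) :
    ∀ k, 3 ≤ k →
      (x (k + 1) = (1 - η ^ 2 • (B * Bᵀ)).mulVec (x k - η • B.mulVec (y k))
        - η ^ 3 • (B * Bᵀ * B).mulVec
            (y k + (2 : ℝ) • y (k - 1) - (3 : ℝ) • y (k - 2) + y (k - 3))) ∧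
      (y (k + 1) = (1 - η ^ 2 • (Bᵀ * B)).mulVec (y k + η • Bᵀ.mulVec (x k))
        + η ^ 3 • (Bᵀ * B * Bᵀ).mulVec
            (x k + (2 : ℝ) • x (k - 1) - (3 : ℝ) • x (k - 2) + x (k - 3))) := by
  intro k hk
  refine ⟨optimistic_gradient_step_decomposition B Bᵀ η x y hx hy k hk, ?_⟩
  have h := optimistic_gradient_step_decomposition Bᵀ B (-η) y x
    (fun k hk => by rw [hy k hk]; module) (fun k hk => by rw [hx k hk]; module) k hk
  simpa only [neg_smul, sub_neg_eq_add, neg_sq, Odd.neg_pow (by decide : Odd 3)] using h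
end
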